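/- arXiv:1002.2674 — 7 statements merged into one kernel-verified Lean document; each statement's English description precedes it below -/
import Mathlib

section
/- Let g be a Lie algebra over k with multiloop data (m, σ, θ) as in the context. If r_i, s_i ∈ ℤ satisfy gcd(r_i, m_i) = 1 and r_i s_i ≡ 1 (mod m_i) for 1 ≤ i ≤ n, then each θ_i^{r_i} again has order m_i, each n-tuple (σ_1^{s_1},…,σ_n^{s_n}) consists of pairwise commuting automorphisms of period dividing m_i, and L_m(g, σ, (θ_1^{r_1},…,θ_n^{r_n})) = L_m(g, (σ_1^{s_1},…,σ_n^{s_n}), θ) as subalgebras of g ⊗_k S_n (indeed as ℤ^n-graded subalgebras). -/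
open scoped TensorProduct

noncomputable section

/-- Laurent polynomials in `n` variables over `k`. -/
abbrev LaurentN (k : Type*) [Field k] (n : ℕ) : Type _ :=
  AddMonoidAlgebra k (Fin n → ℤ)

instance lieAlgebraRestrictBaseChange (k : Type*) [Field k]
    (A : Type*) [CommRing A] [Algebra k A]
    (L : Type*) [LieRing L] [LieAlgebra k L] : LieAlgebra k (A ⊗[k] L) :=
  { (inferInstance : Module k (A ⊗[k] L)) with
    lie_smul := fun c x y => by
      rw [← algebraMap_smul A c y, lie_smul, algebraMap_smul] }

/-- The generating set `{z^κ ⊗ x : x ∈ g^κ}` of the multiloop algebra. -/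
def multiloopGens (k : Type*) [Field k] (n : ℕ)
    (g : Type*) [LieRing g] [LieAlgebra k g]
    (σ : Fin n → (g ≃ₗ[k] g)) (θ : Fin n → kˣ) : Set (LaurentN k n ⊗[k] g) :=
  {w | ∃ (κ : Fin n → ℤ) (x : g),
    (∀ i, σ i x = ((θ i ^ κ i : kˣ) : k) • x) ∧
    w = AddMonoidAlgebra.single κ (1 : k) ⊗ₜ[k] x}

/-- The multiloop algebra `L(g, σ, θ) = ⨁_κ g^κ ⊗ z^κ`, as a Lie subalgebra of `g ⊗ S_n`. -/
def multiloop (k : Type*) [Field k] (n : ℕ)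
    (g : Type*) [LieRing g] [LieAlgebra k g]
    (σ : Fin n → (g ≃ₗ[k] g)) (θ : Fin n → kˣ) :
    LieSubalgebra k (LaurentN k n ⊗[k] g) :=
  LieSubalgebra.lieSpan k _ (multiloopGens k n g σ θ)

/-- An eigenvector of `f` with eigenvalue `c` is an eigenvector of `f ^ a` with eigenvalue `c ^ a`. -/
theorem LinearEquiv.zpow_apply_eq_smul {R M : Type*} [CommRing R] [AddCommGroup M] [Module R M]
    {f : M ≃ₗ[R] M} {c : Rˣ} {x : M} (h : f x = (c : R) • x) (a : ℤ) :
    (f ^ a) x = ((c ^ a : Rˣ) : R) • x := by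
  induction a with
  | zero => simp
  | succ a ih =>
    rw [zpow_add_one, LinearEquiv.mul_apply, h, map_smul, ih, smul_smul, zpow_add_one,
      Units.val_mul, mul_comm]
  | pred a ih =>
    have h_inv : f⁻¹ x = ((c⁻¹ : Rˣ) : R) • x := by
      apply f.injective
      rw [map_smul, h, smul_smul, Units.inv_mul, one_smul, ← LinearEquiv.mul_apply,
        mul_inv_cancel, LinearEquiv.coe_one, id_eq]
    rw [zpow_sub_one, LinearEquiv.mul_apply, h_inv, map_smul, ih, smul_smul, zpow_sub_one,
      Units.val_mul, mul_comm]

/-- Powers of an element of period `m` depend only on the exponent modulo `m`. -/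
theorem zpow_eq_zpow_of_intModEq {G : Type*} [Group G] {x : G} {m : ℕ} (hx : x ^ m = 1)
    {a b : ℤ} (h : a ≡ b [ZMOD m]) : x ^ a = x ^ b :=
  zpow_eq_zpow_iff_modEq.2 (h.of_dvd (Int.natCast_dvd_natCast.2 (orderOf_dvd_of_pow_eq_one hx)))

theorem orderOf_zpow_of_mul_modEq_one {G : Type*} [Group G] {x : G} {r s : ℤ}
    (h : r * s ≡ 1 [ZMOD (orderOf x)]) : orderOf (x ^ r) = orderOf x := by
  refine Nat.dvd_antisymm (orderOf_dvd_of_mem_zpowers ⟨r, rfl⟩) ?_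
  have hx : (x ^ r) ^ s = x := by
    rw [← zpow_mul, zpow_eq_zpow_of_intModEq (pow_orderOf_eq_one x) h, zpow_one]
  exact orderOf_dvd_of_mem_zpowers ⟨s, hx⟩

/-- The eigenspace conditions for `(f, c ^ r)` and for `(f ^ s, c)` agree when `r` and `s` are
inverse to each other modulo a common period of `f` and `c`. -/
theorem LinearEquiv.apply_eq_zpow_smul_iff {R M : Type*} [CommRing R] [AddCommGroup M]
    [Module R M] {f : M ≃ₗ[R] M} {c : Rˣ} {m : ℕ} (hf : f ^ m = 1) (hc : c ^ m = 1) {r s : ℤ}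
    (h : r * s ≡ 1 [ZMOD m]) (a : ℤ) (x : M) :
    f x = (((c ^ r) ^ a : Rˣ) : R) • x ↔ (f ^ s) x = ((c ^ a : Rˣ) : R) • x := by
  constructor
  · intro hx
    rw [LinearEquiv.zpow_apply_eq_smul hx s, ← zpow_mul, ← zpow_mul,
      show r * (a * s) = r * s * a by ring, zpow_mul, zpow_eq_zpow_of_intModEq hc h, zpow_one]
  · intro hx
    have hr := LinearEquiv.zpow_apply_eq_smul hx r
    rwa [← zpow_mul, mul_comm s, zpow_eq_zpow_of_intModEq hf h, zpow_one, zpow_comm c] at hr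

theorem statement2 (k : Type*) [Field k] [IsAlgClosed k] [CharZero k]
    (n : ℕ) (hn : 1 ≤ n) (g : Type*) [LieRing g] [LieAlgebra k g]
    (m : Fin n → ℕ) (hm : ∀ i, 0 < m i)
    (σ : Fin n → (g ≃ₗ[k] g))
    (hσlie : ∀ i x y, σ i ⁅x, y⁆ = ⁅σ i x, σ i y⁆)
    (hσcomm : ∀ i j, Commute (σ i) (σ j))
    (hσord : ∀ i, σ i ^ m i = 1)
    (θ : Fin n → kˣ) (hθ : ∀ i, orderOf (θ i) = m i)
    (r s : Fin n → ℤ)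
    (hgcd : ∀ i, Int.gcd (r i) (m i) = 1)
    (hrs : ∀ i, r i * s i ≡ 1 [ZMOD (m i)]) :
    (∀ i, orderOf (θ i ^ r i) = m i) ∧
    (∀ i j, Commute (σ i ^ s i) (σ j ^ s j)) ∧
    (∀ i, (σ i ^ s i) ^ m i = 1) ∧
    multiloop k n g σ (fun i => θ i ^ r i) = multiloop k n g (fun i => σ i ^ s i) θ := by
  refine ⟨fun i => ?_, fun i j => ((hσcomm i j).zpow_left _).zpow_right _, fun i => ?_, ?_⟩
  · rw [← hθ i]
    exact orderOf_zpow_of_mul_modEq_one ((hθ i).symm ▸ hrs i)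
  · rw [← zpow_natCast, zpow_comm, zpow_natCast, hσord, one_zpow]
  · have hθpow (i) : θ i ^ m i = 1 := hθ i ▸ pow_orderOf_eq_one (θ i)
    simp only [multiloop, multiloopGens,
      LinearEquiv.apply_eq_zpow_smul_iff (hσord _) (hθpow _) (hrs _)]
end
end

section
/- Let g be a Lie algebra over k with multiloop data (m, σ, θ) as in the context, and let r = (r_1,…,r_n) be an n-tuple of positive integers with σ_i^{r_i} = 1 and r_i ∣ m_i for 1 ≤ i ≤ n. Then each θ_i^{m_i/r_i} has order r_i, and the injective k-algebra endomorphism of g ⊗_k S_n induced by the k-algebra map S_n → S_n sending z_i ↦ z_i^{m_i/r_i} restricts to a Lie algebra isomorphism from L_r(g, σ, (θ_1^{m_1/r_1},…,θ_n^{m_n/r_n})) onto L_m(g, σ, θ). In particular these two multiloop algebras are isomorphic as Lie algebras over k. -/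
open scoped TensorProduct

noncomputable section

theorem rTensor_algHom_lie {k : Type*} [Field k] {A B : Type*} [CommRing A] [Algebra k A]
    [CommRing B] [Algebra k B] (g : Type*) [LieRing g] [LieAlgebra k g] (φ : A →ₐ[k] B)
    (x y : A ⊗[k] g) :
    φ.toLinearMap.rTensor g ⁅x, y⁆ = ⁅φ.toLinearMap.rTensor g x, φ.toLinearMap.rTensor g y⁆ := by
  induction x using TensorProduct.induction_on with
  | zero => simp
  | add x₁ x₂ h₁ h₂ => simp only [add_lie, map_add, h₁, h₂]
  | tmul a u =>
    induction y using TensorProduct.induction_on with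
    | zero => simp
    | add y₁ y₂ h₁ h₂ => simp only [lie_add, map_add, h₁, h₂]
    | tmul b v => simp [LieAlgebra.ExtendScalars.bracket_tmul]

theorem LinearEquiv.pow_apply_of_apply_eq_smul {R M : Type*} [CommSemiring R] [AddCommMonoid M]
    [Module R M] (f : M ≃ₗ[R] M) {c : R} {x : M} (h : f x = c • x) (j : ℕ) :
    (f ^ j) x = c ^ j • x := by
  induction j with
  | zero => simp
  | succ j ih => rw [pow_succ, LinearEquiv.mul_apply, h, map_smul, ih, smul_smul, pow_succ']

theorem div_orderOf_dvd_of_zpow_eigenvector {k g : Type*} [Field k] [AddCommGroup g] [Module k g]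
    {f : g ≃ₗ[k] g} {r : ℕ} (hr : 0 < r) (hf : f ^ r = 1) {t : kˣ} (hdvd : r ∣ orderOf t)
    {a : ℤ} {x : g} (hx : x ≠ 0) (h : f x = ((t ^ a : kˣ) : k) • x) :
    (orderOf t / r : ℤ) ∣ a := by
  have h₁ := f.pow_apply_of_apply_eq_smul h r
  rw [hf, LinearEquiv.coe_one, id] at h₁
  have h₂ : ((t ^ a : kˣ) : k) ^ r = 1 := smul_left_injective k hx (by simpa using h₁.symm)
  have h₃ : t ^ (a * r) = 1 := by
    rw [zpow_mul, zpow_natCast]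
    exact Units.ext (by simpa using h₂)
  have h₄ := orderOf_dvd_iff_zpow_eq_one.2 h₃
  obtain ⟨q, hq⟩ := hdvd
  have hr' : (r : ℤ) ≠ 0 := by positivity
  rw [hq] at h₄ ⊢
  push_cast at h₄ ⊢
  rw [Int.mul_ediv_cancel_left _ hr']
  exact Int.dvd_of_mul_dvd_mul_left hr' (by rwa [mul_comm a] at h₄)

theorem image_multiloopGens {k : Type*} [Field k] {n : ℕ} {g : Type*} [LieRing g] [LieAlgebra k g]
    {σ : Fin n → (g ≃ₗ[k] g)} {θ : Fin n → kˣ} {r : Fin n → ℕ} (hr : ∀ i, 0 < r i)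
    (hσ : ∀ i, σ i ^ r i = 1) (hdvd : ∀ i, r i ∣ orderOf (θ i))
    {e : (Fin n → ℤ) →+ (Fin n → ℤ)}
    (he : ∀ κ i, e κ i = (orderOf (θ i) / r i : ℤ) * κ i) :
    (AddMonoidAlgebra.mapDomainAlgHom k k e).toLinearMap.rTensor g ''
        multiloopGens k n g σ (fun i => θ i ^ (orderOf (θ i) / r i)) =
      multiloopGens k n g σ θ := by
  have hzpow (κ : Fin n → ℤ) (i : Fin n) :
      (θ i ^ (orderOf (θ i) / r i)) ^ κ i = θ i ^ e κ i := by
    rw [he, zpow_mul, ← Int.natCast_div, zpow_natCast]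
  apply Set.Subset.antisymm
  · rintro _ ⟨_, ⟨κ, x, hx, rfl⟩, rfl⟩
    exact ⟨e κ, x, fun i => by rw [hx i, hzpow], by simp⟩
  · rintro _ ⟨κ, x, hx, rfl⟩
    rcases eq_or_ne x 0 with rfl | hx0
    · exact ⟨0, ⟨0, 0, by simp, by simp⟩, by simp⟩
    · choose l hl using fun i =>
        div_orderOf_dvd_of_zpow_eigenvector (hr i) (hσ i) (hdvd i) hx0 (hx i)
      have hκ : e l = κ := funext fun i => by rw [he, hl]
      exact ⟨_, ⟨l, x, fun i => by rw [hzpow, hκ, hx], rfl⟩, by simp [hκ]⟩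

theorem statement3 (k : Type*) [Field k] [IsAlgClosed k] [CharZero k]
    (n : ℕ) (hn : 1 ≤ n) (g : Type*) [LieRing g] [LieAlgebra k g]
    (m : Fin n → ℕ) (hm : ∀ i, 0 < m i)
    (σ : Fin n → (g ≃ₗ[k] g))
    (hσlie : ∀ i x y, σ i ⁅x, y⁆ = ⁅σ i x, σ i y⁆)
    (hσcomm : ∀ i j, Commute (σ i) (σ j))
    (hσord : ∀ i, σ i ^ m i = 1)
    (θ : Fin n → kˣ) (hθ : ∀ i, orderOf (θ i) = m i)
    (r : Fin n → ℕ) (hr0 : ∀ i, 0 < r i)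
    (hσr : ∀ i, σ i ^ r i = 1) (hdvd : ∀ i, r i ∣ m i)
    -- the additive map `κ ↦ (m_i/r_i)·κ_i` on exponents, inducing `z_i ↦ z_i^{m_i/r_i}`
    (e : (Fin n → ℤ) →+ (Fin n → ℤ))
    (he : ∀ (κ : Fin n → ℤ) (i : Fin n), e κ i = (m i / r i : ℤ) * κ i)
    -- the induced `k`-algebra endomorphism of `S_n`, tensored with the identity of `g`
    (F : LaurentN k n ⊗[k] g →ₗ[k] LaurentN k n ⊗[k] g)
    (hF : F = LinearMap.rTensor g (AddMonoidAlgebra.mapDomainAlgHom k k e).toLinearMap) :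
    (∀ i, orderOf (θ i ^ (m i / r i)) = r i) ∧
    Function.Injective F ∧
    (∀ x y : LaurentN k n ⊗[k] g, F ⁅x, y⁆ = ⁅F x, F y⁆) ∧
    F '' (multiloop k n g σ (fun i => θ i ^ (m i / r i)) : Set (LaurentN k n ⊗[k] g))
      = (multiloop k n g σ θ : Set (LaurentN k n ⊗[k] g)) ∧
    Nonempty ((multiloop k n g σ (fun i => θ i ^ (m i / r i))) ≃ₗ⁅k⁆ (multiloop k n g σ θ)) := by
  obtain rfl : (fun i => orderOf (θ i)) = m := funext hθ
  have hinj : Function.Injective F := by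
    rw [hF]
    refine Module.Flat.rTensor_preserves_injective_linearMap _
      (AddMonoidAlgebra.mapDomain_injective fun κ κ' h => funext fun i => ?_)
    have hi := congrFun h i
    rw [he, he] at hi
    refine mul_left_cancel₀ ?_ hi
    rw [← Int.natCast_div]
    exact_mod_cast (Nat.div_pos (Nat.le_of_dvd (hm i) (hdvd i)) (hr0 i)).ne'
  have hlie (x y : LaurentN k n ⊗[k] g) : F ⁅x, y⁆ = ⁅F x, F y⁆ := by
    rw [hF]
    exact rTensor_algHom_lie g _ x y
  let f : LaurentN k n ⊗[k] g →ₗ⁅k⁆ LaurentN k n ⊗[k] g := { F with map_lie' := hlie _ _ }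
  have hmap : (multiloop k n g σ (fun i => θ i ^ (orderOf (θ i) / r i))).map f =
      multiloop k n g σ θ := by
    rw [multiloop, LieSubalgebra.map_lieSpan, multiloop, ← image_multiloopGens hr0 hσr hdvd he,
      ← hF]
    rfl
  refine ⟨fun i => ?_, hinj, hlie, congrArg SetLike.coe hmap, ⟨?_⟩⟩
  · have hq : orderOf (θ i) / r i ∣ orderOf (θ i) := Nat.div_dvd_of_dvd (hdvd i)
    rw [orderOf_pow_of_dvd (Nat.div_pos (Nat.le_of_dvd (hm i) (hdvd i)) (hr0 i)).ne' hq,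
      Nat.div_div_self (hdvd i) (hm i).ne']
  · rw [← hmap]
    exact LieSubalgebra.equivMapOfInjective f _ hinj
end
end

section
/- Let g be a Lie algebra over k with multiloop data (m, σ, θ) as in the context, and let b be a Lie ideal of g with σ_i(b) = b for 1 ≤ i ≤ n. Write σ|_b for the n-tuple of restricted automorphisms of b and σ̄ for the n-tuple of automorphisms induced on the quotient Lie algebra g/b. Then L_m(b, σ|_b, θ) (viewed inside g ⊗_k S_n) is a Lie ideal of L_m(g, σ, θ), and the quotient Lie algebra L_m(g,σ,θ) / L_m(b, σ|_b, θ) is isomorphic to L_m(g/b, σ̄, θ), via a ℤ^n-graded Lie algebra isomorphism induced by the canonical map g → g/b. -/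
open scoped TensorProduct

noncomputable section

/-- The linear isomorphism `S_n ⊗ V ≃ ℤⁿ →₀ V` sending `z^κ ⊗ x` to `x` placed in degree `κ`. -/
def laurentTensorEquiv (k : Type*) [Field k] (n : ℕ) (V : Type*) [AddCommGroup V] [Module k V] :
    (LaurentN k n ⊗[k] V) ≃ₗ[k] ((Fin n → ℤ) →₀ V) :=
  TensorProduct.congr (AddMonoidAlgebra.coeffLinearEquiv k) (LinearEquiv.refl k V) ≪≫ₗ
    TensorProduct.finsuppScalarLeft k V (Fin n → ℤ)

theorem laurentTensorEquiv_single_tmul {k : Type*} [Field k] {n : ℕ} {V : Type*} [AddCommGroup V]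
    [Module k V] (κ : Fin n → ℤ) (x : V) :
    laurentTensorEquiv k n V (AddMonoidAlgebra.single κ (1 : k) ⊗ₜ[k] x) = Finsupp.single κ x := by
  have h : AddMonoidAlgebra.coeffLinearEquiv k (AddMonoidAlgebra.single κ (1 : k)) =
      Finsupp.single κ (1 : k) := rfl
  rw [laurentTensorEquiv, LinearEquiv.trans_apply, TensorProduct.congr_tmul, h,
    LinearEquiv.refl_apply, ← LinearEquiv.eq_symm_apply,
    TensorProduct.finsuppScalarLeft_symm_apply_single]

theorem laurentTensorEquiv_symm_single {k : Type*} [Field k] {n : ℕ} {V : Type*} [AddCommGroup V]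
    [Module k V] (κ : Fin n → ℤ) (x : V) :
    (laurentTensorEquiv k n V).symm (Finsupp.single κ x) =
      AddMonoidAlgebra.single κ (1 : k) ⊗ₜ[k] x := by
  rw [LinearEquiv.symm_apply_eq, laurentTensorEquiv_single_tmul]

theorem laurentTensorEquiv_lTensor {k : Type*} [Field k] {n : ℕ} {V W : Type*} [AddCommGroup V]
    [Module k V] [AddCommGroup W] [Module k W] (f : V →ₗ[k] W) (w : LaurentN k n ⊗[k] V)
    (κ : Fin n → ℤ) :
    laurentTensorEquiv k n W (f.lTensor (LaurentN k n) w) κ = f (laurentTensorEquiv k n V w κ) := by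
  induction w with
  | zero => simp
  | tmul a x => simp [laurentTensorEquiv]
  | add a b ha hb => simp only [map_add, Finsupp.add_apply, ha, hb]

/-- Averaging over a cyclic group projects onto an eigenspace, compatibly with any linear map whose
value at `x` lies in the corresponding eigenspace. -/
theorem exists_eigenvector_map_eq {k V W : Type*} [Field k] [CharZero k] [AddCommGroup V]
    [Module k V] [AddCommGroup W] [Module k W] (f : V →ₗ[k] W) {m : ℕ} (hm : 0 < m)
    (T : V ≃ₗ[k] V) (hT : T ^ m = 1) (c : kˣ) (hc : c ^ m = 1) (x : V)
    (hx : ∀ j : ℕ, f ((T ^ j) x) = ((c ^ j : kˣ) : k) • f x) :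
    ∃ y, f y = f x ∧ T y = (c : k) • y ∧
      ∀ (S : V ≃ₗ[k] V) (d : k), Commute S T → S x = d • x → S y = d • y := by
  have hm' : (m : k) ≠ 0 := by exact_mod_cast hm.ne'
  let u : ℕ → V := fun j => (((c ^ j)⁻¹ : kˣ) : k) • (T ^ j) x
  refine ⟨(m : k)⁻¹ • ∑ j ∈ Finset.range m, u j, ?_, ?_, ?_⟩
  · have h : ∀ j ∈ Finset.range m, f (u j) = f x := fun j _ => by
      simp only [u, map_smul, hx, smul_smul, ← Units.val_mul, inv_mul_cancel, Units.val_one,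
        one_smul]
    rw [map_smul, map_sum, Finset.sum_congr rfl h, Finset.sum_const, Finset.card_range,
      ← Nat.cast_smul_eq_nsmul k, smul_smul, inv_mul_cancel₀ hm', one_smul]
  · have h : ∀ j ∈ Finset.range m, T (u j) = (c : k) • u (j + 1) := fun j _ => by
      simp only [u, map_smul, smul_smul, ← Units.val_mul, pow_succ' T, LinearEquiv.mul_apply]
      congr 2
      rw [pow_succ, mul_inv, mul_comm, inv_mul_cancel_right]
    have hu : ∑ j ∈ Finset.range m, u (j + 1) = ∑ j ∈ Finset.range m, u j := by
      have h₁ := Finset.sum_range_succ u m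
      rw [Finset.sum_range_succ'] at h₁
      have h₂ : u m = u 0 := by
        simp only [u, hT, hc, pow_zero]
      rw [h₂] at h₁
      exact add_right_cancel h₁
    rw [map_smul, map_sum, Finset.sum_congr rfl h, ← Finset.smul_sum, hu, smul_comm]
  · intro S d hS hSx
    have h : ∀ j ∈ Finset.range m, S (u j) = d • u j := fun j _ => by
      have hj : S ((T ^ j) x) = (T ^ j) (S x) := LinearEquiv.congr_fun (hS.pow_right j).eq x
      simp only [u, map_smul, hj, hSx]
      rw [smul_comm]
    rw [map_smul, map_sum, Finset.sum_congr rfl h, ← Finset.smul_sum, smul_comm]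

/-- Simultaneous eigenvectors lift along a surjection intertwining commuting automorphisms of
finite order. -/
theorem exists_simultaneous_eigenvector_lift {k V W ι : Type*} [Field k] [CharZero k] [Finite ι]
    [AddCommGroup V] [Module k V] [AddCommGroup W] [Module k W] (f : V →ₗ[k] W)
    (hf : Function.Surjective f) (m : ι → ℕ) (hm : ∀ i, 0 < m i) (σ : ι → (V ≃ₗ[k] V))
    (hσcomm : ∀ i j, Commute (σ i) (σ j)) (hσord : ∀ i, σ i ^ m i = 1) (τ : ι → (W ≃ₗ[k] W))
    (hτ : ∀ i x, τ i (f x) = f (σ i x)) (c : ι → kˣ) (hc : ∀ i, c i ^ m i = 1) (w : W)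
    (hw : ∀ i, τ i w = (c i : k) • w) :
    ∃ y, f y = w ∧ ∀ i, σ i y = (c i : k) • y := by
  classical
  have := Fintype.ofFinite ι
  suffices h : ∀ s : Finset ι, ∃ y, f y = w ∧ ∀ i ∈ s, σ i y = (c i : k) • y by
    obtain ⟨y, hy, hσ⟩ := h Finset.univ
    exact ⟨y, hy, fun i => hσ i (Finset.mem_univ i)⟩
  intro s
  induction s using Finset.induction_on with
  | empty => exact (hf w).imp fun y hy => ⟨hy, by simp⟩
  | insert a s _ ih =>
    obtain ⟨x, hx, hσx⟩ := ih
    have hpow : ∀ j : ℕ, f ((σ a ^ j) x) = ((c a ^ j : kˣ) : k) • f x := by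
      intro j
      induction j with
      | zero => simp
      | succ j ihj =>
        rw [pow_succ', LinearEquiv.mul_apply, ← hτ, ihj, map_smul, hx, hw, smul_smul, pow_succ,
          Units.val_mul]
    obtain ⟨y, hy, hay, hSy⟩ :=
      exists_eigenvector_map_eq f (hm a) (σ a) (hσord a) (c a) (hc a) x hpow
    refine ⟨y, hy.trans hx, fun i hi => ?_⟩
    rcases Finset.mem_insert.1 hi with rfl | hi
    · exact hay
    · exact hSy _ _ (hσcomm i a) (hσx i hi)

theorem Submodule.lie_mem_of_mem_span {k L : Type*} [CommRing k] [LieRing L] [LieAlgebra k L]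
    {s t : Set L} {N : Submodule k L} (h : ∀ x ∈ s, ∀ y ∈ t, ⁅x, y⁆ ∈ N) {x y : L}
    (hx : x ∈ Submodule.span k s) (hy : y ∈ Submodule.span k t) : ⁅x, y⁆ ∈ N := by
  induction hx, hy using Submodule.span_induction₂ with
  | mem_mem x y hx hy => exact h x hx y hy
  | zero_left => simp
  | zero_right => simp
  | add_left x y z _ _ _ h₁ h₂ => rw [add_lie]; exact N.add_mem h₁ h₂
  | add_right x y z _ _ _ h₁ h₂ => rw [lie_add]; exact N.add_mem h₁ h₂
  | smul_left r x y _ _ h => rw [smul_lie]; exact N.smul_mem r h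
  | smul_right r x y _ _ h => rw [lie_smul]; exact N.smul_mem r h

theorem lie_mem_eigenspace {k : Type*} [Field k] {n : ℕ} {g : Type*} [LieRing g] [LieAlgebra k g]
    {σ : Fin n → (g ≃ₗ[k] g)} (hσ : ∀ i x y, σ i ⁅x, y⁆ = ⁅σ i x, σ i y⁆) {θ : Fin n → kˣ}
    {κ μ : Fin n → ℤ} {x y : g} (hx : ∀ i, σ i x = ((θ i ^ κ i : kˣ) : k) • x)
    (hy : ∀ i, σ i y = ((θ i ^ μ i : kˣ) : k) • y) (i : Fin n) :
    σ i ⁅x, y⁆ = ((θ i ^ (κ + μ) i : kˣ) : k) • ⁅x, y⁆ := by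
  rw [hσ, hx, hy, smul_lie, lie_smul, smul_smul, ← Units.val_mul, ← zpow_add, Pi.add_apply]

theorem lTensor_lie {k A L M : Type*} [Field k] [CommRing A] [Algebra k A] [LieRing L]
    [LieAlgebra k L] [LieRing M] [LieAlgebra k M] (f : L →ₗ[k] M)
    (hf : ∀ x y, f ⁅x, y⁆ = ⁅f x, f y⁆) (x y : A ⊗[k] L) :
    f.lTensor A ⁅x, y⁆ = ⁅f.lTensor A x, f.lTensor A y⁆ := by
  induction x with
  | zero =>
    refine (congrArg _ (zero_lie y)).trans ?_
    rw [map_zero]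
    exact (zero_lie _).symm
  | add x x' hx hx' =>
    refine (congrArg _ (add_lie x x' y)).trans ?_
    rw [map_add, map_add]
    exact (congrArg₂ _ hx hx').trans (add_lie _ _ _).symm
  | tmul p x =>
    induction y with
    | zero =>
      refine (congrArg _ (lie_zero (p ⊗ₜ[k] x))).trans ?_
      rw [map_zero]
      exact (lie_zero _).symm
    | add y y' hy hy' =>
      refine (congrArg _ (lie_add (p ⊗ₜ[k] x) y y')).trans ?_
      rw [map_add, map_add]
      exact (congrArg₂ _ hy hy').trans (lie_add _ _ _).symm
    | tmul q y => simp only [LieAlgebra.ExtendScalars.bracket_tmul, LinearMap.lTensor_tmul, hf]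

theorem lie_single_tmul {k : Type*} [Field k] {n : ℕ} {g : Type*} [LieRing g] [LieAlgebra k g]
    (κ μ : Fin n → ℤ) (x y : g) :
    ⁅(AddMonoidAlgebra.single κ (1 : k) ⊗ₜ[k] x : LaurentN k n ⊗[k] g),
      (AddMonoidAlgebra.single μ (1 : k) ⊗ₜ[k] y : LaurentN k n ⊗[k] g)⁆ =
      AddMonoidAlgebra.single (κ + μ) (1 : k) ⊗ₜ[k] ⁅x, y⁆ := by
  rw [LieAlgebra.ExtendScalars.bracket_tmul, AddMonoidAlgebra.single_mul_single, one_mul]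

theorem multiloop_toSubmodule {k : Type*} [Field k] {n : ℕ} {g : Type*} [LieRing g]
    [LieAlgebra k g] {σ : Fin n → (g ≃ₗ[k] g)} (hσ : ∀ i x y, σ i ⁅x, y⁆ = ⁅σ i x, σ i y⁆)
    (θ : Fin n → kˣ) :
    (multiloop k n g σ θ).toSubmodule = Submodule.span k (multiloopGens k n g σ θ) := by
  let M : LieSubalgebra k (LaurentN k n ⊗[k] g) :=
    { Submodule.span k (multiloopGens k n g σ θ) with
      lie_mem' := fun {x y} hx hy => by
        refine Submodule.lie_mem_of_mem_span ?_ hx hy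
        rintro _ ⟨κ, x, hx, rfl⟩ _ ⟨μ, y, hy, rfl⟩
        exact Submodule.subset_span
          ⟨κ + μ, ⁅x, y⁆, lie_mem_eigenspace hσ hx hy, lie_single_tmul κ μ x y⟩ }
  apply le_antisymm
  · have h : multiloop k n g σ θ ≤ M := LieSubalgebra.lieSpan_le.2 Submodule.subset_span
    exact h
  · exact Submodule.span_le.2 LieSubalgebra.subset_lieSpan

theorem laurentTensorEquiv_apply_mem_eigenspace {k : Type*} [Field k] {n : ℕ} {g : Type*}
    [LieRing g] [LieAlgebra k g] {σ : Fin n → (g ≃ₗ[k] g)} {θ : Fin n → kˣ}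
    {w : LaurentN k n ⊗[k] g} (hw : w ∈ Submodule.span k (multiloopGens k n g σ θ))
    (κ : Fin n → ℤ) (i : Fin n) :
    σ i (laurentTensorEquiv k n g w κ) =
      ((θ i ^ κ i : kˣ) : k) • laurentTensorEquiv k n g w κ := by
  classical
  induction hw using Submodule.span_induction with
  | mem w h =>
    obtain ⟨μ, x, hx, rfl⟩ := h
    rw [laurentTensorEquiv_single_tmul, Finsupp.single_apply]
    split_ifs with h
    · rw [← h, hx]
    · simp
  | zero => simp
  | add x y _ _ hx hy => simp only [map_add, Finsupp.add_apply, hx, hy, smul_add]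
  | smul a x _ hx => simp only [map_smul, Finsupp.smul_apply, hx]; rw [smul_comm]

theorem statement4 (k : Type*) [Field k] [IsAlgClosed k] [CharZero k]
    (n : ℕ) (hn : 1 ≤ n) (g : Type*) [LieRing g] [LieAlgebra k g]
    (m : Fin n → ℕ) (hm : ∀ i, 0 < m i)
    (σ : Fin n → (g ≃ₗ[k] g))
    (hσlie : ∀ i x y, σ i ⁅x, y⁆ = ⁅σ i x, σ i y⁆)
    (hσcomm : ∀ i j, Commute (σ i) (σ j))
    (hσord : ∀ i, σ i ^ m i = 1)
    (θ : Fin n → kˣ) (hθ : ∀ i, orderOf (θ i) = m i)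
    -- a Lie ideal `b` of `g`, stable under each `σ_i`
    (b : LieIdeal k g) (hb : ∀ i, ∀ x ∈ b, σ i x ∈ b)
    -- the restricted automorphisms `σ|_b` of `b`
    (σb : Fin n → (b ≃ₗ[k] b)) (hσb : ∀ i (x : b), ((σb i x : g)) = σ i (x : g))
    -- the induced automorphisms `σ̄` of `g/b`
    (σq : Fin n → ((g ⧸ b) ≃ₗ[k] (g ⧸ b)))
    (hσq : ∀ i (x : g), σq i (LieSubmodule.Quotient.mk' (b : LieSubmodule k g g) x)
      = LieSubmodule.Quotient.mk' (b : LieSubmodule k g g) (σ i x)) :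
    -- `L_m(b, σ|_b, θ)`, viewed inside `g ⊗ S_n`
    letI Lb : Submodule k (LaurentN k n ⊗[k] g) :=
      Submodule.span k {w | ∃ (κ : Fin n → ℤ) (x : b),
        (∀ i, σb i x = ((θ i ^ κ i : kˣ) : k) • x) ∧
        w = AddMonoidAlgebra.single κ (1 : k) ⊗ₜ[k] (x : g)}
    -- the base change `id ⊗ π` of the canonical map `π : g → g/b`
    letI ψ : LaurentN k n ⊗[k] g →ₗ[k] LaurentN k n ⊗[k] (g ⧸ b) :=
      LinearMap.lTensor (LaurentN k n)
        (LieSubmodule.Quotient.mk' (b : LieSubmodule k g g) : g →ₗ[k] g ⧸ b)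
    -- (a)  `L_m(b, σ|_b, θ)` is a Lie ideal of `L_m(g, σ, θ)`:
    ((Lb : Set (LaurentN k n ⊗[k] g)) ⊆ (multiloop k n g σ θ : Set (LaurentN k n ⊗[k] g))) ∧
    (∀ x ∈ multiloop k n g σ θ, ∀ y ∈ Lb, ⁅x, y⁆ ∈ Lb) ∧
    -- (b)  the canonical map `g → g/b` induces a graded isomorphism
    --      `L_m(g,σ,θ)/L_m(b,σ|_b,θ) ≃ L_m(g/b, σ̄, θ)`:
    (∀ x y : LaurentN k n ⊗[k] g, ψ ⁅x, y⁆ = ⁅ψ x, ψ y⁆) ∧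
    (ψ '' (multiloop k n g σ θ : Set (LaurentN k n ⊗[k] g))
      = (multiloop k n (g ⧸ b) σq θ : Set (LaurentN k n ⊗[k] (g ⧸ b)))) ∧
    (∀ w ∈ multiloop k n g σ θ, (ψ w = 0 ↔ w ∈ Lb)) := by
  set π : g →ₗ[k] g ⧸ b :=
    (LieSubmodule.Quotient.mk' (b : LieSubmodule k g g) : g →ₗ[k] g ⧸ b)
  have hπ : Function.Surjective π := LieSubmodule.Quotient.surjective_mk' (b : LieSubmodule k g g)
  have hπlie (x y : g) : π ⁅x, y⁆ = ⁅π x, π y⁆ := rfl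
  have hπσ (i : Fin n) (x : g) : σq i (π x) = π (σ i x) := hσq i x
  have hσqlie (i : Fin n) (x y : g ⧸ b) : σq i ⁅x, y⁆ = ⁅σq i x, σq i y⁆ := by
    obtain ⟨x, rfl⟩ := hπ x
    obtain ⟨y, rfl⟩ := hπ y
    rw [← hπlie, hπσ, hσlie, hπlie, hπσ, hπσ]
  have hbeig (c : Fin n → k) (x : b) :
      (∀ i, σb i x = c i • x) ↔ ∀ i, σ i (x : g) = c i • (x : g) := by
    refine forall_congr' fun i => ?_
    rw [← hσb, Subtype.ext_iff]
    rfl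
  have hmem (w : LaurentN k n ⊗[k] g) :
      w ∈ multiloop k n g σ θ ↔ w ∈ Submodule.span k (multiloopGens k n g σ θ) := by
    rw [← multiloop_toSubmodule hσlie, LieSubalgebra.mem_toSubmodule]
  refine ⟨?_, ?_, ?_, ?_, ?_⟩
  · intro w hw
    refine (hmem w).2 (Submodule.span_mono ?_ hw)
    rintro _ ⟨κ, x, hx, rfl⟩
    exact ⟨κ, x, (hbeig _ x).1 hx, rfl⟩
  · intro x hx y hy
    refine Submodule.lie_mem_of_mem_span ?_ ((hmem x).1 hx) hy
    rintro _ ⟨κ, x, hx, rfl⟩ _ ⟨μ, y, hy, rfl⟩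
    refine Submodule.subset_span ⟨κ + μ, ⟨⁅x, (y : g)⁆, lie_mem_right k g b x y y.2⟩, ?_,
      lie_single_tmul κ μ x (y : g)⟩
    exact (hbeig _ _).2 (lie_mem_eigenspace hσlie hx ((hbeig _ y).1 hy))
  · exact lTensor_lie π hπlie
  · have hq : ((multiloop k n (g ⧸ b) σq θ : Set (LaurentN k n ⊗[k] (g ⧸ b)))) =
        (Submodule.span k (multiloopGens k n (g ⧸ b) σq θ) : Set _) := by
      rw [← multiloop_toSubmodule hσqlie]
      rfl
    have hg : ((multiloop k n g σ θ : Set (LaurentN k n ⊗[k] g))) =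
        (Submodule.span k (multiloopGens k n g σ θ) : Set _) := Set.ext hmem
    rw [hq, hg, ← Submodule.map_coe, Submodule.map_span]
    congr 2
    ext w
    constructor
    · rintro ⟨_, ⟨κ, x, hx, rfl⟩, rfl⟩
      exact ⟨κ, π x, fun i => by rw [hπσ, hx, map_smul], LinearMap.lTensor_tmul _ _ _ _⟩
    · rintro ⟨κ, x, hx, rfl⟩
      obtain ⟨y, rfl, hy⟩ := exists_simultaneous_eigenvector_lift π hπ m hm σ hσcomm hσord σq hπσ
        (fun i => θ i ^ κ i)
        (fun i => by
          rw [← hθ i, ← zpow_natCast, zpow_comm, zpow_natCast, pow_orderOf_eq_one, one_zpow]) x hx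
      exact ⟨_, ⟨κ, y, hy, rfl⟩, LinearMap.lTensor_tmul _ _ _ _⟩
  · intro w hw
    constructor
    · intro h0
      rw [← (laurentTensorEquiv k n g).symm_apply_apply w,
        ← Finsupp.sum_single (laurentTensorEquiv k n g w), Finsupp.sum, map_sum]
      refine Submodule.sum_mem _ fun κ _ => ?_
      have hκ : laurentTensorEquiv k n g w κ ∈ b := by
        refine (LieSubmodule.Quotient.mk_eq_zero (b : LieSubmodule k g g)).1 ?_
        have h := laurentTensorEquiv_lTensor π w κ
        rw [h0, map_zero] at h
        exact h.symm
      rw [laurentTensorEquiv_symm_single]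
      exact Submodule.subset_span ⟨κ, ⟨_, hκ⟩, (hbeig _ _).2
        (laurentTensorEquiv_apply_mem_eigenspace ((hmem w).1 hw) κ), rfl⟩
    · intro hw
      rw [← LinearMap.mem_ker]
      refine Submodule.span_le.2 ?_ hw
      rintro _ ⟨κ, x, -, rfl⟩
      have hx : π (x : g) = 0 := (LieSubmodule.Quotient.mk_eq_zero _).2 x.2
      rw [SetLike.mem_coe, LinearMap.mem_ker, LinearMap.lTensor_tmul, hx, TensorProduct.tmul_zero]
end
end

section
/- Let g be a finite-dimensional simple Lie algebra over k with multiloop data (m, σ, θ) as in the context, and set L = L_m(g,σ,θ). Let R be the k-subalgebra of S_n generated by z_1^{m_1}, …, z_n^{m_n} and their inverses. Then for every r ∈ R, multiplication by r on g ⊗_k S_n maps L into L, and the resulting k-algebra homomorphism from R to the centroid of L (sending r to the restriction to L of multiplication by r) is bijective. In particular the centroid of L is isomorphic as a k-algebra to the Laurent polynomial algebra in n variables over k. -/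
open scoped TensorProduct

noncomputable section

open AddMonoidAlgebra

section Simple

variable {k g : Type*} [Field k] [LieRing g] [LieAlgebra k g]

lemma eq_zero_of_forall_lie_eq_zero [LieAlgebra.IsSimple k g] {x : g}
    (h : ∀ y : g, ⁅x, y⁆ = 0) : x = 0 := by
  have hx : x ∈ LieAlgebra.center k g := by
    rw [LieModule.mem_maxTrivSubmodule]
    intro y
    rw [← lie_skew, h, neg_zero]
  simpa using hx

/-- Schur's lemma for the adjoint representation of a simple Lie algebra. -/
lemma exists_eq_smul_of_map_lie [IsAlgClosed k] [Module.Finite k g] [LieAlgebra.IsSimple k g]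
    (f : g →ₗ[k] g) (hf : ∀ x y, f ⁅x, y⁆ = ⁅f x, y⁆) : ∃ c : k, ∀ x, f x = c • x := by
  have : Nontrivial g := LieAlgebra.IsSimple.nontrivial k g
  obtain ⟨c, hc⟩ := Module.End.exists_eigenvalue f
  obtain ⟨v, hv⟩ := hc.exists_hasEigenvector
  let I : LieIdeal k g :=
    { Module.End.eigenspace f c with
      lie_mem := by
        intro x y hy
        have hy' : f y = c • y := Module.End.mem_eigenspace_iff.1 hy
        change ⁅x, y⁆ ∈ Module.End.eigenspace f c
        rw [Module.End.mem_eigenspace_iff, ← lie_skew, map_neg, hf, hy', smul_lie, smul_neg] }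
  refine ⟨c, fun x => ?_⟩
  have hI : I = ⊤ := by
    refine (LieAlgebra.IsSimple.eq_bot_or_eq_top I).resolve_left fun h => hv.2 ?_
    have : v ∈ I := hv.1
    simpa [h] using this
  have hx : x ∈ I := by simp [hI]
  exact Module.End.mem_eigenspace_iff.1 hx

end Simple

section Eigen

variable {k g : Type*} [Field k] [AddCommGroup g] [Module k g] {n : ℕ}

/-- The simultaneous eigenvectors of commuting automorphisms of finite order span. -/
lemma span_simultaneous_eigenvectors [IsAlgClosed k] [CharZero k] [Module.Finite k g]
    {m : Fin n → ℕ} (hm : ∀ i, 0 < m i) {σ : Fin n → (g ≃ₗ[k] g)}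
    (hσcomm : ∀ i j, Commute (σ i) (σ j)) (hσord : ∀ i, σ i ^ m i = 1)
    {θ : Fin n → kˣ} (hθ : ∀ i, orderOf (θ i) = m i) :
    Submodule.span k {x : g | ∃ κ : Fin n → ℤ, ∀ i, σ i x = ((θ i ^ κ i : kˣ) : k) • x} = ⊤ := by
  let f : Fin n → Module.End k g := fun i => (σ i : g →ₗ[k] g)
  have hpow : ∀ i, f i ^ m i = 1 := by
    intro i
    ext x
    have h := LinearEquiv.congr_fun (hσord i) x
    have h2 : ∀ j : ℕ, (f i ^ j) x = (σ i ^ j) x := by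
      intro j
      induction j with
      | zero => rfl
      | succ j ih => rw [pow_succ', pow_succ', Module.End.mul_apply, ih]; rfl
    rw [h2, h]; rfl
  have hss : ∀ i, (f i).IsFinitelySemisimple := by
    intro i
    refine (Module.End.isSemisimple_of_squarefree_aeval_eq_zero
      (p := Polynomial.X ^ m i - 1) ?_ (by simp [hpow])).isFinitelySemisimple
    refine (Polynomial.separable_X_pow_sub_C (1 : k) ?_ one_ne_zero).squarefree
    exact_mod_cast (hm i).ne'
  rw [eq_top_iff,
    ← Module.End.iSup_iInf_maxGenEigenspace_eq_top_of_iSup_maxGenEigenspace_eq_top_of_commute f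
      (fun i j _ => ?_) (fun i => Module.End.iSup_maxGenEigenspace_eq_top (f i))]
  · refine iSup_le fun χ x hx => ?_
    have hx' : ∀ i, f i x = χ i • x := by
      intro i
      have := (Submodule.mem_iInf _).1 hx i
      rwa [(hss i).maxGenEigenspace_eq_eigenspace, Module.End.mem_eigenspace_iff] at this
    by_cases h0 : x = 0
    · simp [h0]
    have hχ : ∀ i, ∃ a : ℕ, (θ i : k) ^ a = χ i := by
      intro i
      have h1 : χ i ^ m i = 1 := by
        have h2 : ∀ j : ℕ, (f i ^ j) x = χ i ^ j • x := by
          intro j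
          induction j with
          | zero => simp
          | succ j ih => rw [pow_succ', Module.End.mul_apply, ih, map_smul, hx', smul_smul, pow_succ]
        have h3 := h2 (m i)
        rw [hpow] at h3
        exact (smul_left_injective k h0 (by simpa using h3)).symm
      have : NeZero (m i) := ⟨(hm i).ne'⟩
      have hp : IsPrimitiveRoot (θ i : k) (m i) := by
        rw [← hθ i, IsPrimitiveRoot.coe_units_iff]
        exact IsPrimitiveRoot.orderOf _
      obtain ⟨a, -, ha⟩ := hp.eq_pow_of_pow_eq_one h1
      exact ⟨a, ha⟩
    choose a ha using hχ
    refine Submodule.subset_span ⟨fun i => a i, fun i => ?_⟩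
    rw [zpow_natCast, Units.val_pow_eq_pow_val, ha]
    exact hx' i
  · ext x
    exact LinearEquiv.congr_fun (hσcomm i j) x

end Eigen

section Laurent

variable (k : Type*) [Field k] {n : ℕ}

/-- The endomorphism `z_i ↦ z_i ^ m_i` of the Laurent polynomial algebra. -/
def laurentPow (m : Fin n → ℕ) : LaurentN k n →ₐ[k] LaurentN k n :=
  mapDomainAlgHom k k
    ({ toFun := fun κ i => m i * κ i
       map_zero' := by ext; simp
       map_add' := fun _ _ => by ext; simp [mul_add] } : (Fin n → ℤ) →+ (Fin n → ℤ))

lemma laurentPow_single (m : Fin n → ℕ) (κ : Fin n → ℤ) (c : k) :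
    laurentPow k m (single κ c) = single (fun i => m i * κ i) c := by
  simp [laurentPow]

lemma laurentPow_injective {m : Fin n → ℕ} (hm : ∀ i, 0 < m i) :
    Function.Injective (laurentPow k m) := by
  refine mapDomain_injective fun a b h => funext fun i => ?_
  have hi : (m i : ℤ) * a i = m i * b i := congrFun h i
  have := (hm i).ne'
  exact mul_left_cancel₀ (by exact_mod_cast this) hi

lemma adjoin_eq_range_laurentPow (m : Fin n → ℕ) :
    Algebra.adjoin k {w : LaurentN k n | ∃ i : Fin n,
        w = single (Pi.single i (m i : ℤ)) (1 : k) ∨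
        w = single (Pi.single i (-(m i : ℤ))) (1 : k)} = (laurentPow k m).range := by
  apply le_antisymm
  · rw [Algebra.adjoin_le_iff]
    rintro w ⟨i, rfl | rfl⟩
    · refine ⟨single (Pi.single i 1) 1, ?_⟩
      refine (laurentPow_single k m _ _).trans ?_
      congr 1
      ext j
      by_cases h : j = i
      · subst h; simp
      · simp [h]
    · refine ⟨single (Pi.single i (-1)) 1, ?_⟩
      refine (laurentPow_single k m _ _).trans ?_
      congr 1
      ext j
      by_cases h : j = i
      · subst h; simp
      · simp [h]
  · set R := Algebra.adjoin k {w : LaurentN k n | ∃ i : Fin n,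
        w = single (Pi.single i (m i : ℤ)) (1 : k) ∨
        w = single (Pi.single i (-(m i : ℤ))) (1 : k)}
    have h1 : ∀ i (t : ℤ), (single (Pi.single i (m i * t)) 1 : LaurentN k n) ∈ R := by
      intro i t
      obtain ⟨a, rfl | rfl⟩ := t.eq_nat_or_neg
      · have := pow_mem (Algebra.subset_adjoin ⟨i, Or.inl rfl⟩ :
          (single (Pi.single i (m i : ℤ)) 1 : LaurentN k n) ∈ R) a
        rwa [single_pow, one_pow, ← Pi.single_smul, nsmul_eq_mul, mul_comm] at this
      · have := pow_mem (Algebra.subset_adjoin ⟨i, Or.inr rfl⟩ :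
          (single (Pi.single i (-(m i : ℤ))) 1 : LaurentN k n) ∈ R) a
        rwa [single_pow, one_pow, ← Pi.single_smul, nsmul_eq_mul, mul_neg, mul_comm,
          ← mul_neg] at this
    have h2 : ∀ (κ : Fin n → ℤ) (s : Finset (Fin n)),
        (single (∑ i ∈ s, Pi.single i (m i * κ i)) 1 : LaurentN k n) ∈ R := by
      intro κ s
      induction s using Finset.induction_on with
      | empty => exact one_mem R
      | insert i s hi ih =>
        rw [Finset.sum_insert hi, ← mul_one (1 : k), ← single_mul_single]
        exact mul_mem (h1 i _) ih
    rintro _ ⟨s, rfl⟩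
    change laurentPow k m s ∈ R
    rw [← s.sum_coeff_single, Finsupp.sum, map_sum]
    refine sum_mem fun κ _ => ?_
    rw [laurentPow_single, ← mul_one (s.coeff κ), ← smul_eq_mul, ← smul_single]
    have h3 := h2 κ Finset.univ
    rw [Finset.univ_sum_single (fun i => (m i : ℤ) * κ i)] at h3
    exact R.smul_mem h3 _

lemma mem_range_laurentPow_iff {m : Fin n → ℕ} {s : LaurentN k n} :
    s ∈ (laurentPow k m).range ↔ ∀ l, s.coeff l ≠ 0 → ∀ i, (m i : ℤ) ∣ l i := by
  constructor
  · rintro ⟨t, rfl⟩ l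
    contrapose!
    rintro ⟨i, hi⟩
    refine Finsupp.mapDomain_of_notMem_range t.coeff l ?_
    rintro ⟨κ, rfl⟩
    exact hi (dvd_mul_right _ _)
  · intro h
    rw [← s.sum_coeff_single]
    refine sum_mem fun l hl => ?_
    choose t ht using h l (Finsupp.mem_support_iff.1 hl)
    refine ⟨single t (s.coeff l), ?_⟩
    refine (laurentPow_single k m _ _).trans ?_
    congr 1
    exact (funext ht).symm

end Laurent

section GradedLoop

open Module

variable {k A G g : Type*} [Field k] [CommRing A] [Algebra k A] [LieRing g]
  [LieAlgebra k g]

lemma equivFinsuppOfBasisLeft_lie [DecidableEq G] (b : Basis G k A) (w : A ⊗[k] g) (y : g) (l : G) :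
    TensorProduct.equivFinsuppOfBasisLeft b ⁅w, (1 : A) ⊗ₜ[k] y⁆ l =
      ⁅TensorProduct.equivFinsuppOfBasisLeft b w l, y⁆ := by
  induction w with
  | zero => simp
  | tmul s x => simp [LieAlgebra.ExtendScalars.bracket_tmul]
  | add u v hu hv => simp [add_lie, hu, hv]

/-- The Lie algebra spanned by the elements `b κ ⊗ x` with `x` in the homogeneous component
`E κ`. -/
def gradedLoop (b : Basis G k A) (E : G → Submodule k g) : LieSubalgebra k (A ⊗[k] g) :=
  LieSubalgebra.lieSpan k _ {w | ∃ (κ : G) (x : g), x ∈ E κ ∧ w = b κ ⊗ₜ[k] x}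

variable {b : Basis G k A} {E : G → Submodule k g}

lemma tmul_mem_gradedLoop {κ : G} {x : g} (hx : x ∈ E κ) :
    b κ ⊗ₜ[k] x ∈ gradedLoop b E :=
  LieSubalgebra.subset_lieSpan ⟨κ, x, hx, rfl⟩

lemma coeff_mem_of_mem_gradedLoop [AddCommGroup G] [DecidableEq G]
    (hadd : ∀ κ l, b (κ + l) = b κ * b l)
    (hE : ∀ κ l, ∀ x ∈ E κ, ∀ y ∈ E l, ⁅x, y⁆ ∈ E (κ + l))
    {w : A ⊗[k] g} (hw : w ∈ gradedLoop b E) (l : G) :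
    TensorProduct.equivFinsuppOfBasisLeft b w l ∈ E l := by
  set S : Set (A ⊗[k] g) := {w | ∃ (κ : G) (x : g), x ∈ E κ ∧ w = b κ ⊗ₜ[k] x} with hS
  have hspan : w ∈ Submodule.span k S := by
    rw [gradedLoop] at hw
    induction hw using LieSubalgebra.lieSpan_induction with
    | mem x h => exact Submodule.subset_span h
    | zero => exact zero_mem _
    | add x y _ _ hx hy => exact add_mem hx hy
    | smul c x _ hx => exact Submodule.smul_mem _ c hx
    | lie x y hx' hy' hx hy =>
      clear hx' hy'
      induction hx, hy using Submodule.span_induction₂ with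
      | mem_mem x y hx hy =>
        obtain ⟨κ, x, hx, rfl⟩ := hx
        obtain ⟨l, y, hy, rfl⟩ := hy
        refine Submodule.subset_span ⟨κ + l, ⁅x, y⁆, hE _ _ _ hx _ hy, ?_⟩
        rw [LieAlgebra.ExtendScalars.bracket_tmul, hadd]
      | zero_left y _ => simp
      | zero_right x _ => simp
      | add_left x y z _ _ _ hx hy => rw [add_lie]; exact add_mem hx hy
      | add_right x y z _ _ _ hx hy => rw [lie_add]; exact add_mem hx hy
      | smul_left c x y _ _ h => rw [smul_lie]; exact Submodule.smul_mem _ c h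
      | smul_right c x y _ _ h => rw [lie_smul]; exact Submodule.smul_mem _ c h
  clear hw
  induction hspan using Submodule.span_induction with
  | mem w h =>
    obtain ⟨κ, x, hx, rfl⟩ := h
    by_cases h : κ = l
    · subst h; simpa using hx
    · simp [h]
  | zero => simp
  | add x y _ _ hx hy => simpa using add_mem hx hy
  | smul c x _ hx => simpa using Submodule.smul_mem _ c hx

lemma basis_smul_mem_gradedLoop [AddCommGroup G] (hadd : ∀ κ l, b (κ + l) = b κ * b l)
    {l : G} (hl : ∀ κ, E κ ≤ E (l + κ))
    {w : A ⊗[k] g} (hw : w ∈ gradedLoop b E) : b l • w ∈ gradedLoop b E := by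
  rw [gradedLoop] at hw
  induction hw using LieSubalgebra.lieSpan_induction with
  | mem x h =>
    obtain ⟨κ, x, hx, rfl⟩ := h
    rw [TensorProduct.smul_tmul', smul_eq_mul, ← hadd]
    exact tmul_mem_gradedLoop (hl κ hx)
  | zero => simp
  | add x y _ _ hx hy => rw [smul_add]; exact add_mem hx hy
  | smul c x _ hx => rw [smul_comm]; exact (gradedLoop b E).smul_mem c hx
  | lie x y _ hy hx _ => rw [← smul_lie]; exact (gradedLoop b E).lie_mem hx hy

/-- An element of the loop algebra is zero if it commutes with the graded loop algebra. -/
lemma eq_zero_of_forall_gradedLoop_lie_eq_zero [AddCommGroup G] [DecidableEq G]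
    [LieAlgebra.IsSimple k g]
    (hzero : b 0 = 1) (hadd : ∀ κ l, b (κ + l) = b κ * b l)
    (hspan : ⨆ κ, E κ = ⊤) {w : A ⊗[k] g} (hw : ∀ v ∈ gradedLoop b E, ⁅w, v⁆ = 0) : w = 0 := by
  have h1 : ∀ y : g, ⁅w, (1 : A) ⊗ₜ[k] y⁆ = 0 := by
    intro y
    have hy : y ∈ ⨆ κ, E κ := by simp [hspan]
    induction hy using Submodule.iSup_induction' with
    | mem κ y hy =>
      have h := congrArg (b (-κ) • ·) (hw _ (tmul_mem_gradedLoop hy))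
      rwa [smul_zero, ← lie_smul, TensorProduct.smul_tmul', smul_eq_mul, ← hadd,
        neg_add_cancel, hzero] at h
    | zero => simp
    | add x y _ _ hx hy => rw [TensorProduct.tmul_add, lie_add, hx, hy, add_zero]
  apply (TensorProduct.equivFinsuppOfBasisLeft b).injective
  ext l
  rw [map_zero, Finsupp.zero_apply]
  refine eq_zero_of_forall_lie_eq_zero (k := k) fun y => ?_
  rw [← equivFinsuppOfBasisLeft_lie, h1, map_zero, Finsupp.zero_apply]

/-- A linear map commuting with right multiplications by a simple Lie algebra is scalar. -/
lemma exists_eq_tmul_of_map_lie [DecidableEq G]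
    [IsAlgClosed k] [Module.Finite k g] [LieAlgebra.IsSimple k g]
    (b : Basis G k A) (F : g →ₗ[k] A ⊗[k] g) (hF : ∀ x y, F ⁅x, y⁆ = ⁅F x, (1 : A) ⊗ₜ[k] y⁆) :
    ∃ s : A, ∀ x, F x = s ⊗ₜ[k] x := by
  have hc : ∀ l : G, ∃ c : k, ∀ x, TensorProduct.equivFinsuppOfBasisLeft b (F x) l = c • x := by
    intro l
    refine exists_eq_smul_of_map_lie (Finsupp.lapply l ∘ₗ
      (TensorProduct.equivFinsuppOfBasisLeft b).toLinearMap ∘ₗ F) fun x y => ?_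
    simp [hF, equivFinsuppOfBasisLeft_lie]
  choose c hc using hc
  have : Nontrivial g := LieAlgebra.IsSimple.nontrivial k g
  obtain ⟨x, hx⟩ := exists_ne (0 : g)
  have hfin : (Function.support c).Finite := by
    refine (TensorProduct.equivFinsuppOfBasisLeft b (F x)).hasFiniteSupport.subset fun l hl => ?_
    rw [Function.mem_support, hc]
    exact smul_ne_zero hl hx
  refine ⟨b.repr.symm (Finsupp.ofSupportFinite c hfin), fun y => ?_⟩
  apply (TensorProduct.equivFinsuppOfBasisLeft b).injective
  ext l
  simp [hc, Finsupp.ofSupportFinite_coe]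

/-- Every element of the centroid of a graded loop algebra is a multiplication. -/
lemma exists_eq_smul_of_centroid [AddCommGroup G] [DecidableEq G]
    [IsAlgClosed k] [Module.Finite k g] [LieAlgebra.IsSimple k g]
    (hzero : b 0 = 1) (hadd : ∀ κ l, b (κ + l) = b κ * b l) (hspan : ⨆ κ, E κ = ⊤)
    (e : Module.End k (gradedLoop b E))
    (he : ∀ x y, e ⁅x, y⁆ = ⁅e x, y⁆ ∧ e ⁅x, y⁆ = ⁅x, e y⁆) :
    ∃ s : A, ∀ x, ((e x : gradedLoop b E) : A ⊗[k] g) = s • (x : A ⊗[k] g) := by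
  have hsw : ∀ u v : gradedLoop b E, ⁅((e u : gradedLoop b E) : A ⊗[k] g), (v : A ⊗[k] g)⁆ =
      ⁅(u : A ⊗[k] g), ((e v : gradedLoop b E) : A ⊗[k] g)⁆ := by
    intro u v
    rw [← LieSubalgebra.coe_bracket, ← LieSubalgebra.coe_bracket, ← (he u v).1, (he u v).2]
  let P : g → A ⊗[k] g → Prop := fun x w =>
    ∀ v : gradedLoop b E,
      ⁅w, (v : A ⊗[k] g)⁆ = ⁅(1 : A) ⊗ₜ[k] x, ((e v : gradedLoop b E) : A ⊗[k] g)⁆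
  have hadd' : ∀ {x y w w'}, P x w → P y w' → P (x + y) (w + w') := by
    intro x y w w' h h' v
    rw [add_lie, h v, h' v, TensorProduct.tmul_add, add_lie]
  have hsmul' : ∀ (c : k) {x w}, P x w → P (c • x) (c • w) := by
    intro c x w h v
    rw [smul_lie, h v, TensorProduct.tmul_smul, smul_lie]
  have huniq : ∀ {x w w'}, P x w → P x w' → w = w' := by
    intro x w w' h h'
    rw [← sub_eq_zero]
    refine eq_zero_of_forall_gradedLoop_lie_eq_zero hzero hadd hspan fun v hv => ?_
    rw [sub_lie, h ⟨v, hv⟩, h' ⟨v, hv⟩, sub_self]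
  have hhom : ∀ {κ x} (hx : x ∈ E κ),
      P x (b (-κ) • ((e ⟨_, tmul_mem_gradedLoop hx⟩ : gradedLoop b E) : A ⊗[k] g)) := by
    intro κ x hx v
    rw [smul_lie, hsw, ← smul_lie, TensorProduct.smul_tmul', smul_eq_mul, ← hadd,
      neg_add_cancel, hzero]
  have hex : ∀ x, ∃ w, P x w := by
    intro x
    have hx : x ∈ ⨆ κ, E κ := by simp [hspan]
    induction hx using Submodule.iSup_induction' with
    | mem κ x hx => exact ⟨_, hhom hx⟩
    | zero => exact ⟨0, fun v => by simp⟩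
    | add x y _ _ hx hy =>
      obtain ⟨w, hw⟩ := hx
      obtain ⟨w', hw'⟩ := hy
      exact ⟨_, hadd' hw hw'⟩
  choose f hf using hex
  let F : g →ₗ[k] A ⊗[k] g :=
    { toFun := f
      map_add' := fun x y => huniq (hf _) (hadd' (hf x) (hf y))
      map_smul' := fun c x => huniq (hf _) (hsmul' c (hf x)) }
  have hFhom : ∀ {κ x} (hx : x ∈ E κ),
      F x = b (-κ) • ((e ⟨_, tmul_mem_gradedLoop hx⟩ : gradedLoop b E) : A ⊗[k] g) :=
    fun hx => huniq (hf _) (hhom hx)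
  have hFlie : ∀ x y, F ⁅x, y⁆ = ⁅F x, (1 : A) ⊗ₜ[k] y⁆ := by
    intro x y
    refine huniq (hf _) fun v => ?_
    have hy : y ∈ ⨆ κ, E κ := by simp [hspan]
    induction hy using Submodule.iSup_induction' with
    | mem κ y hy =>
      have hy1 : (1 : A) ⊗ₜ[k] y = b (-κ) • (b κ ⊗ₜ[k] y) := by
        rw [TensorProduct.smul_tmul', smul_eq_mul, ← hadd, neg_add_cancel, hzero]
      let u : gradedLoop b E := ⟨_, tmul_mem_gradedLoop hy⟩
      have h1 := hf x ⁅u, v⁆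
      have h2 := hf x v
      rw [(he u v).2, LieSubalgebra.coe_bracket, LieSubalgebra.coe_bracket] at h1
      have h3 : ((1 : A) ⊗ₜ[k] ⁅x, y⁆ : A ⊗[k] g) = ⁅(1 : A) ⊗ₜ[k] x, (1 : A) ⊗ₜ[k] y⁆ := by
        rw [LieAlgebra.ExtendScalars.bracket_tmul, mul_one]
      have h4 : ∀ t : A ⊗[k] g, ⁅(1 : A) ⊗ₜ[k] y, t⁆ = b (-κ) • ⁅(u : A ⊗[k] g), t⁆ := by
        intro t
        rw [hy1, smul_lie]
      rw [lie_lie, h3, lie_lie, h4, h4, h4, h4, lie_smul, lie_smul]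
      change b (-κ) • ⁅f x, _⁆ - b (-κ) • ⁅_, ⁅f x, _⁆⁆ = _
      rw [h1, h2]
    | zero => simp
    | add y z _ _ hy hz =>
      rw [TensorProduct.tmul_add, lie_add, add_lie, hy, hz, lie_add, TensorProduct.tmul_add,
        add_lie]
  obtain ⟨s, hs⟩ := exists_eq_tmul_of_map_lie b F hFlie
  refine ⟨s, ?_⟩
  rintro ⟨w, hw⟩
  induction hw using LieSubalgebra.lieSpan_induction with
  | mem w h =>
    obtain ⟨κ, x, hx, rfl⟩ := h
    have h := congrArg (b κ • ·) ((hFhom hx).symm.trans (hs x))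
    simp only [smul_smul, ← hadd, add_neg_cancel, hzero, one_smul] at h
    rw [h, TensorProduct.smul_tmul', TensorProduct.smul_tmul', smul_eq_mul, smul_eq_mul, mul_comm]
  | zero => exact (congrArg Subtype.val (map_zero e)).trans (smul_zero s).symm
  | add x y hx hy h h' =>
    have := congrArg Subtype.val (map_add e ⟨x, hx⟩ ⟨y, hy⟩)
    exact this.trans ((congrArg₂ (· + ·) h h').trans (smul_add s x y).symm)
  | smul c x hx h =>
    have := congrArg Subtype.val (map_smul e c ⟨x, hx⟩)
    exact this.trans ((congrArg (c • ·) h).trans (smul_comm c s x))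
  | lie x y hx hy h _ =>
    have := congrArg Subtype.val (he ⟨x, hx⟩ ⟨y, hy⟩).1
    refine this.trans ?_
    rw [LieSubalgebra.coe_bracket, h, smul_lie]

lemma smul_mem_gradedLoop [AddCommGroup G] (hadd : ∀ κ l, b (κ + l) = b κ * b l) {s : A}
    (hs : ∀ l, b.repr s l ≠ 0 → ∀ κ, E κ ≤ E (l + κ))
    {w : A ⊗[k] g} (hw : w ∈ gradedLoop b E) : s • w ∈ gradedLoop b E := by
  rw [← b.linearCombination_repr s, Finsupp.linearCombination_apply, Finsupp.sum,
    Finset.sum_smul]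
  refine sum_mem fun l hl => ?_
  rw [smul_assoc]
  exact (gradedLoop b E).smul_mem _
    (basis_smul_mem_gradedLoop hadd (hs l (Finsupp.mem_support_iff.1 hl)) hw)

lemma repr_mul_basis [AddCommGroup G] (hadd : ∀ κ l, b (κ + l) = b κ * b l) (s : A) (κ l : G) :
    b.repr (s * b κ) (l + κ) = b.repr s l := by
  classical
  induction b.mem_span s using Submodule.span_induction with
  | mem x h =>
    obtain ⟨i, rfl⟩ := h
    simp [← hadd, Finsupp.single_apply]
  | zero => simp
  | add x y _ _ hx hy => simp [add_mul, hx, hy]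
  | smul c x _ hx => simp [hx]

lemma exists_ne_zero_mem [LieAlgebra.IsSimple k g] (hspan : ⨆ κ, E κ = ⊤) :
    ∃ κ, ∃ x ∈ E κ, x ≠ 0 := by
  have : Nontrivial g := LieAlgebra.IsSimple.nontrivial k g
  by_contra! h
  have hbot : ⨆ κ, E κ = ⊥ := iSup_eq_bot.2 fun κ => (Submodule.eq_bot_iff _).2 (h κ)
  exact bot_ne_top (hbot.symm.trans hspan)

/-- If multiplication by `s` preserves the graded loop algebra, then every degree in the support
of `s` shifts some nonzero homogeneous component to one meeting it nontrivially. -/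
lemma exists_mem_of_smul_mem_gradedLoop [AddCommGroup G] [DecidableEq G]
    [LieAlgebra.IsSimple k g]
    (hadd : ∀ κ l, b (κ + l) = b κ * b l)
    (hE : ∀ κ l, ∀ x ∈ E κ, ∀ y ∈ E l, ⁅x, y⁆ ∈ E (κ + l)) (hspan : ⨆ κ, E κ = ⊤) {s : A}
    (hs : ∀ w ∈ gradedLoop b E, s • w ∈ gradedLoop b E) {l : G} (hl : b.repr s l ≠ 0) :
    ∃ κ, ∃ x ≠ 0, x ∈ E κ ∧ x ∈ E (l + κ) := by
  obtain ⟨κ, x, hx, hx0⟩ := exists_ne_zero_mem (k := k) hspan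
  have h := coeff_mem_of_mem_gradedLoop hadd hE (hs _ (tmul_mem_gradedLoop hx)) (l + κ)
  rw [TensorProduct.smul_tmul', smul_eq_mul,
    TensorProduct.equivFinsuppOfBasisLeft_apply_tmul_apply, repr_mul_basis hadd] at h
  exact ⟨κ, x, hx0, hx, (Submodule.smul_mem_iff _ hl).1 h⟩

lemma eq_of_forall_smul_eq [AddCommGroup G] [DecidableEq G]
    [LieAlgebra.IsSimple k g]
    (hadd : ∀ κ l, b (κ + l) = b κ * b l) (hspan : ⨆ κ, E κ = ⊤) {r s : A}
    (h : ∀ w ∈ gradedLoop b E, r • w = s • w) : r = s := by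
  obtain ⟨κ, x, hx, hx0⟩ := exists_ne_zero_mem (k := k) hspan
  refine b.ext_elem fun l => ?_
  have hl := congrArg (TensorProduct.equivFinsuppOfBasisLeft b · (l + κ))
    (h _ (tmul_mem_gradedLoop hx))
  simp only [TensorProduct.smul_tmul', smul_eq_mul,
    TensorProduct.equivFinsuppOfBasisLeft_apply_tmul_apply, repr_mul_basis hadd] at hl
  exact smul_left_injective k hx0 hl

/-- Multiplications by the elements of `R` form the centroid of the graded loop algebra, when `R`
is spanned by the basis elements whose degree preserves the grading. -/
theorem gradedLoop_centroid [AddCommGroup G] [DecidableEq G]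
    [IsAlgClosed k] [Module.Finite k g] [LieAlgebra.IsSimple k g]
    (hzero : b 0 = 1) (hadd : ∀ κ l, b (κ + l) = b κ * b l)
    (hE : ∀ κ l, ∀ x ∈ E κ, ∀ y ∈ E l, ⁅x, y⁆ ∈ E (κ + l)) (hspan : ⨆ κ, E κ = ⊤)
    {R : Subalgebra k A} (M : Set G) (hR : ∀ s, s ∈ R ↔ ∀ l, b.repr s l ≠ 0 → l ∈ M)
    (hM : ∀ l ∈ M, ∀ κ, E κ ≤ E (l + κ))
    (hM' : ∀ l κ, ∀ x ≠ 0, x ∈ E κ → x ∈ E (l + κ) → l ∈ M) :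
    (∀ r ∈ R, ∀ w ∈ gradedLoop b E, r • w ∈ gradedLoop b E) ∧
    (∀ e : Module.End k (gradedLoop b E),
      ((∀ x y : gradedLoop b E, e ⁅x, y⁆ = ⁅e x, y⁆ ∧ e ⁅x, y⁆ = ⁅x, e y⁆) ↔
        ∃ r ∈ R, ∀ x : gradedLoop b E, ((e x : gradedLoop b E) : A ⊗[k] g) = r • (x : A ⊗[k] g))) ∧
    (∀ r ∈ R, ∀ r' ∈ R, (∀ w ∈ gradedLoop b E, r • w = r' • w) → r = r') := by
  refine ⟨fun r hr w hw => smul_mem_gradedLoop hadd (fun l hl => hM l ((hR r).1 hr l hl)) hw,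
    fun e => ⟨fun he => ?_, ?_⟩, fun r _ r' _ h => eq_of_forall_smul_eq hadd hspan h⟩
  · obtain ⟨s, hs⟩ := exists_eq_smul_of_centroid hzero hadd hspan e he
    refine ⟨s, (hR s).2 fun l hl => ?_, hs⟩
    have hmem : ∀ w ∈ gradedLoop b E, s • w ∈ gradedLoop b E := fun w hw => by
      rw [← hs ⟨w, hw⟩]
      exact (e ⟨w, hw⟩).2
    obtain ⟨κ, x, hx0, hx, hx'⟩ := exists_mem_of_smul_mem_gradedLoop hadd hE hspan hmem hl
    exact hM' l κ x hx0 hx hx'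
  · rintro ⟨r, -, hr⟩ x y
    constructor <;> apply Subtype.ext
    · rw [hr, LieSubalgebra.coe_bracket, LieSubalgebra.coe_bracket, hr, smul_lie]
    · rw [hr, LieSubalgebra.coe_bracket, LieSubalgebra.coe_bracket, hr, lie_smul]

end GradedLoop

section Multiloop

variable (k : Type*) [Field k] {n : ℕ} {g : Type*} [LieRing g] [LieAlgebra k g]

/-- The simultaneous eigenspaces `g^κ` of the automorphisms `σ i`. -/
def multiloopComponent (σ : Fin n → (g ≃ₗ[k] g)) (θ : Fin n → kˣ) (κ : Fin n → ℤ) :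
    Submodule k g where
  carrier := {x | ∀ i, σ i x = ((θ i ^ κ i : kˣ) : k) • x}
  zero_mem' := by simp
  add_mem' hx hy i := by rw [map_add, hx i, hy i, smul_add]
  smul_mem' c x hx i := by rw [map_smul, hx i, smul_comm]

end Multiloop

theorem statement6 (k : Type*) [Field k] [IsAlgClosed k] [CharZero k]
    (n : ℕ) (hn : 1 ≤ n)
    -- `g` is a finite-dimensional simple Lie algebra over `k`
    (g : Type*) [LieRing g] [LieAlgebra k g]
    [Module.Finite k g] [LieAlgebra.IsSimple k g]
    (m : Fin n → ℕ) (hm : ∀ i, 0 < m i)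
    (σ : Fin n → (g ≃ₗ[k] g))
    (hσlie : ∀ i x y, σ i ⁅x, y⁆ = ⁅σ i x, σ i y⁆)
    (hσcomm : ∀ i j, Commute (σ i) (σ j))
    (hσord : ∀ i, σ i ^ m i = 1)
    (θ : Fin n → kˣ) (hθ : ∀ i, orderOf (θ i) = m i) :
    -- `R` is the subalgebra of `S_n` generated by `z_1^{±m_1}, …, z_n^{±m_n}`
    letI R : Subalgebra k (LaurentN k n) :=
      Algebra.adjoin k {w : LaurentN k n | ∃ i : Fin n,
        w = AddMonoidAlgebra.single (Pi.single i (m i : ℤ)) (1 : k) ∨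
        w = AddMonoidAlgebra.single (Pi.single i (-(m i : ℤ))) (1 : k)}
    letI L : LieSubalgebra k (LaurentN k n ⊗[k] g) := multiloop k n g σ θ
    -- (1) multiplication by any `r ∈ R` maps `L` into `L`
    (∀ r ∈ R, ∀ w ∈ L, r • w ∈ L) ∧
    -- (2) an endomorphism of `L` lies in the centroid iff it is induced by
    --     multiplication by some `r ∈ R`
    (∀ e : Module.End k ↥L,
      ((∀ x y : ↥L, e ⁅x, y⁆ = ⁅e x, y⁆ ∧ e ⁅x, y⁆ = ⁅x, e y⁆) ↔
        ∃ r ∈ R, ∀ x : ↥L,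
          ((e x : LaurentN k n ⊗[k] g)) = r • ((x : LaurentN k n ⊗[k] g)))) ∧
    -- (3) the resulting homomorphism `R → centroid` is injective
    (∀ r ∈ R, ∀ r' ∈ R, (∀ w ∈ L, r • w = r' • w) → r = r') ∧
    -- in particular, the centroid of `L` is isomorphic as a `k`-algebra to the Laurent
    -- polynomial algebra in `n` variables over `k`
    Nonempty (↥R ≃ₐ[k] LaurentN k n) := by
  rw [adjoin_eq_range_laurentPow]
  have hspan : ⨆ κ, multiloopComponent k σ θ κ = ⊤ := by
    rw [eq_top_iff, ← span_simultaneous_eigenvectors hm hσcomm hσord hθ, Submodule.span_le]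
    rintro x ⟨κ, hx⟩
    exact Submodule.mem_iSup_of_mem κ hx
  have hE : ∀ κ l, ∀ x ∈ multiloopComponent k σ θ κ, ∀ y ∈ multiloopComponent k σ θ l,
      ⁅x, y⁆ ∈ multiloopComponent k σ θ (κ + l) := by
    intro κ l x hx y hy i
    rw [hσlie, hx i, hy i, smul_lie, lie_smul, smul_smul, Pi.add_apply, zpow_add, Units.val_mul]
  have hM : ∀ l ∈ {l : Fin n → ℤ | ∀ i, (m i : ℤ) ∣ l i}, ∀ κ,
      multiloopComponent k σ θ κ ≤ multiloopComponent k σ θ (l + κ) := by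
    intro l hl κ x hx i
    have : θ i ^ l i = 1 := orderOf_dvd_iff_zpow_eq_one.1 (hθ i ▸ hl i)
    rw [hx i, Pi.add_apply, zpow_add, this, one_mul]
  have hM' : ∀ l κ, ∀ x ≠ 0, x ∈ multiloopComponent k σ θ κ →
      x ∈ multiloopComponent k σ θ (l + κ) → l ∈ {l : Fin n → ℤ | ∀ i, (m i : ℤ) ∣ l i} := by
    intro l κ x hx0 hx hx' i
    have h := Units.ext (smul_left_injective k hx0 ((hx i).symm.trans (hx' i)))
    rw [Pi.add_apply, zpow_add, right_eq_mul] at h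
    rw [← hθ i]
    exact orderOf_dvd_iff_zpow_eq_one.2 h
  obtain ⟨h1, h2, h3⟩ := gradedLoop_centroid (b := AddMonoidAlgebra.basis (Fin n → ℤ) k) rfl
    (fun κ l => by simp [AddMonoidAlgebra.single_mul_single]) hE hspan _
    (fun _ => mem_range_laurentPow_iff k) hM hM'
  exact ⟨h1, h2, h3, ⟨(AlgEquiv.ofInjective _ (laurentPow_injective k hm)).symm⟩⟩
end
end

section
/- Let θ ∈ k^× have finite order m. Then there is a k-algebra isomorphism from the quantum torus Q(θ) onto the associative multiloop algebra L_{(m,m)}(Mat_m(k), (D_m(θ), P_m(1)), (θ,θ)) sending x_1 ↦ p_m(1) ⊗ z_1 and x_2 ↦ d_m(θ)^{−1} ⊗ z_2. (Here D_m(θ) and P_m(1) are commuting k-algebra automorphisms of Mat_m(k) of period m.) -/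
open scoped TensorProduct

noncomputable section

/-- Conjugation `Ad(u) : x ↦ u x u⁻¹` by a unit `u`, as a `k`-algebra automorphism. -/
def Ad {k A : Type*} [CommSemiring k] [Ring A] [Algebra k A] (u : Aˣ) : A ≃ₐ[k] A where
  toFun x := u * x * ↑u⁻¹
  invFun x := ↑u⁻¹ * x * u
  left_inv x := by simp [mul_assoc]
  right_inv x := by simp [mul_assoc]
  map_mul' x y := by simp [mul_assoc]
  map_add' x y := by simp [mul_add, add_mul]
  commutes' r := by
    show (u : A) * algebraMap k A r * ↑u⁻¹ = algebraMap k A r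
    rw [← Algebra.commutes r (u : A)]
    simp [mul_assoc]

variable {F : Type*} [CommRing F]

/-- `d_m(u) = diag(1, u, …, u^{m-1})`, as a unit of the matrix algebra. -/
def dUnit (m : ℕ) (u : Fˣ) : (Matrix (Fin m) (Fin m) F)ˣ where
  val := Matrix.diagonal fun i => (u : F) ^ (i : ℕ)
  inv := Matrix.diagonal fun i => ((u⁻¹ : Fˣ) : F) ^ (i : ℕ)
  val_inv := by
    ext i j
    simp only [Matrix.diagonal_mul_diagonal, Matrix.diagonal_apply, Matrix.one_apply,
      ← Units.val_pow_eq_pow_val, ← Units.val_mul, inv_pow]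
    split
    · simp
    · rfl
  inv_val := by
    ext i j
    simp only [Matrix.diagonal_mul_diagonal, Matrix.diagonal_apply, Matrix.one_apply,
      ← Units.val_pow_eq_pow_val, ← Units.val_mul, inv_pow]
    split
    · simp
    · rfl

/-- `p_m(u)`: the matrix with `(1,m)`-entry `u`, `(i+1,i)`-entries `1`, and all other
entries `0` (indices taken cyclically via `Fin m`), as a unit of the matrix algebra. -/
def pUnit (m : ℕ) [NeZero m] (u : Fˣ) : (Matrix (Fin m) (Fin m) F)ˣ where
  val := Matrix.of fun i j => if i = j + 1 then (if (j : ℕ) = m - 1 then (u : F) else 1) else 0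
  inv := Matrix.of fun i j =>
    if j = i + 1 then (if (i : ℕ) = m - 1 then ((u⁻¹ : Fˣ) : F) else 1) else 0
  val_inv := by
    ext i j
    rw [Matrix.mul_apply, Finset.sum_eq_single (i - 1)]
    · by_cases hij : j = i
      · subst hij
        by_cases hlast : ((j - 1 : Fin m) : ℕ) = m - 1
        · simp [sub_add_cancel, hlast, Matrix.one_apply]
        · simp [sub_add_cancel, hlast, Matrix.one_apply]
      · have h1 : ¬(j = i - 1 + 1) := by rw [sub_add_cancel]; exact hij
        simp [sub_add_cancel, h1, Matrix.one_apply, hij, Ne.symm hij]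
    · intro l _ hl
      have h2 : ¬(i = l + 1) := fun h => hl (by rw [h, add_sub_cancel_right])
      simp [h2]
    · intro h
      exact absurd (Finset.mem_univ _) h
  inv_val := by
    ext i j
    rw [Matrix.mul_apply, Finset.sum_eq_single (i + 1)]
    · by_cases hij : i = j
      · subst hij
        by_cases hlast : (i : ℕ) = m - 1
        · simp [hlast, Matrix.one_apply]
        · simp [hlast, Matrix.one_apply]
      · have h1 : ¬(i + 1 = j + 1) := fun h => hij (add_right_cancel h)
        simp [h1, Matrix.one_apply, hij]
    · intro l _ hl
      simp [hl]
    · intro h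
      exact absurd (Finset.mem_univ _) h

/-- The defining relations of the quantum torus `Q(θ)`:  `x_1 x_1⁻¹ = x_1⁻¹ x_1 = 1`,
`x_2 x_2⁻¹ = x_2⁻¹ x_2 = 1` and `x_1 x_2 = θ x_2 x_1`, where the four generators
`x_1, x_2, x_1⁻¹, x_2⁻¹` are the images of the indices `0, 1, 2, 3`. -/
inductive QRel (k : Type*) [Field k] (θ : k) :
    FreeAlgebra k (Fin 4) → FreeAlgebra k (Fin 4) → Prop
  | inv_one : QRel k θ (FreeAlgebra.ι k 0 * FreeAlgebra.ι k 2) 1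
  | inv_one' : QRel k θ (FreeAlgebra.ι k 2 * FreeAlgebra.ι k 0) 1
  | inv_two : QRel k θ (FreeAlgebra.ι k 1 * FreeAlgebra.ι k 3) 1
  | inv_two' : QRel k θ (FreeAlgebra.ι k 3 * FreeAlgebra.ι k 1) 1
  | q_comm : QRel k θ (FreeAlgebra.ι k 0 * FreeAlgebra.ι k 1)
      (algebraMap k (FreeAlgebra k (Fin 4)) θ * (FreeAlgebra.ι k 1 * FreeAlgebra.ι k 0))

/-- The quantum torus `Q(θ)` determined by `θ ∈ k^×`. -/
abbrev QT (k : Type*) [Field k] (θ : k) : Type _ := RingQuot (QRel k θ)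

/-- The distinguished generators of `Q(θ)`:  `qx k θ 0 = x_1`, `qx k θ 1 = x_2`,
`qx k θ 2 = x_1⁻¹`, `qx k θ 3 = x_2⁻¹`. -/
def qx (k : Type*) [Field k] (θ : k) (i : Fin 4) : QT k θ :=
  RingQuot.mkAlgHom k (QRel k θ) (FreeAlgebra.ι k i)


/-- Laurent polynomials in two variables `z_1, z_2` over `k`:  `S_2 = k[z_1^{±1}, z_2^{±1}]`. -/
abbrev STwo (k : Type*) [Field k] : Type _ := AddMonoidAlgebra k (ℤ × ℤ)

/-- The generating set `{a ⊗ z_1^{κ_1} z_2^{κ_2} : a ∈ A^κ}` of the (associative)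
multiloop algebra `L_{(m₁,m₂)}(A, (σ₁,σ₂), (θ₁,θ₂))`. -/
def aGens (k : Type*) [Field k] (A : Type*) [Ring A] [Algebra k A]
    (σ₁ σ₂ : A ≃ₐ[k] A) (θ₁ θ₂ : kˣ) : Set (A ⊗[k] STwo k) :=
  {w | ∃ (κ : ℤ × ℤ) (a : A),
    σ₁ a = ((θ₁ ^ κ.1 : kˣ) : k) • a ∧ σ₂ a = ((θ₂ ^ κ.2 : kˣ) : k) • a ∧
    w = a ⊗ₜ[k] AddMonoidAlgebra.single κ (1 : k)}

/-- The (associative) multiloop algebra `L_{(m₁,m₂)}(A, (σ₁,σ₂), (θ₁,θ₂)) =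
⨁_κ A^κ ⊗ z^κ`, as a unital subalgebra of `A ⊗ S_2`. -/
def multiloopAssoc (k : Type*) [Field k] (A : Type*) [Ring A] [Algebra k A]
    (σ₁ σ₂ : A ≃ₐ[k] A) (θ₁ θ₂ : kˣ) : Subalgebra k (A ⊗[k] STwo k) :=
  Algebra.adjoin k (aGens k A σ₁ σ₂ θ₁ θ₂)

section GroupRelation

variable {G : Type*} [Group G] {t u v : G}

theorem zpow_mul_zpow_of_mul_eq (hu : Commute t u) (hv : Commute t v)
    (h : u * v = t * (v * u)) (a b : ℤ) :
    u ^ a * v ^ b = t ^ (a * b) * (v ^ b * u ^ a) := by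
  have h1 : SemiconjBy u (v ^ b) (t ^ b * v ^ b) := by
    rw [← hv.mul_zpow]
    exact SemiconjBy.zpow_right (by rw [SemiconjBy, h, mul_assoc]) b
  have h2 : SemiconjBy (v ^ b) (t ^ b * u) u := by
    rw [SemiconjBy, h1.eq, ← mul_assoc, (hv.zpow_zpow b b).eq]
  have h3 := h2.zpow_right a
  rw [(hu.zpow_left b).mul_zpow, ← zpow_mul, mul_comm b a] at h3
  rw [← h3.eq, ← mul_assoc, ← mul_assoc, (hv.zpow_zpow (a * b) b).eq]

theorem conj_left_monomial (hu : Commute t u) (hv : Commute t v)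
    (h : v⁻¹ * u = t * (u * v⁻¹)) (a b : ℤ) :
    v⁻¹ * (u ^ a * v ^ b) * v = t ^ a * (u ^ a * v ^ b) := by
  have := zpow_mul_zpow_of_mul_eq hv.inv_right hu h 1 a
  rw [zpow_one, one_mul] at this
  rw [← mul_assoc, this]
  simp only [mul_assoc]
  rw [((Commute.refl v).zpow_left b).eq, inv_mul_cancel_left]

theorem conj_right_monomial (hu : Commute t u) (hv : Commute t v)
    (h : u * v = t * (v * u)) (a b : ℤ) :
    u * (u ^ a * v ^ b) * u⁻¹ = t ^ b * (u ^ a * v ^ b) := by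
  have := zpow_mul_zpow_of_mul_eq hu hv h 1 b
  rw [zpow_one, one_mul] at this
  rw [← mul_assoc, ((Commute.refl u).zpow_right a).eq, mul_assoc (u ^ a), this,
    mul_assoc, mul_assoc, mul_assoc, mul_inv_cancel, mul_one, ← mul_assoc, ← mul_assoc,
    (hu.zpow_zpow b a).eq]

theorem monomial_mul_monomial (hu : Commute t u) (hv : Commute t v)
    (h : u * v = t * (v * u)) (a b c d : ℤ) :
    u ^ a * v ^ b * (u ^ c * v ^ d) = t ^ (-(c * b)) * (u ^ (a + c) * v ^ (b + d)) := by
  have h1 : v ^ b * u ^ c = t ^ (-(c * b)) * (u ^ c * v ^ b) := by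
    rw [zpow_mul_zpow_of_mul_eq hu hv h, zpow_neg, inv_mul_cancel_left]
  calc u ^ a * v ^ b * (u ^ c * v ^ d) = u ^ a * (v ^ b * u ^ c) * v ^ d := by
        simp only [mul_assoc]
    _ = u ^ a * t ^ (-(c * b)) * (u ^ c * v ^ b) * v ^ d := by rw [h1]; simp only [mul_assoc]
    _ = _ := by
        rw [← (hu.zpow_zpow (-(c * b)) a).eq, zpow_add, zpow_add]; simp only [mul_assoc]

end GroupRelation

section ScalarUnit

variable (k : Type*) [Field k] (A : Type*) [Ring A] [Algebra k A]

/-- The scalar units of a `k`-algebra. -/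
def scalarUnit : kˣ →* Aˣ := Units.map (algebraMap k A : k →* A)

variable {k A}

theorem scalarUnit_commute (t : kˣ) (u : Aˣ) : Commute (scalarUnit k A t) u :=
  Units.ext (Algebra.commutes (t : k) (u : A))

theorem val_scalarUnit_mul (t : kˣ) (u : Aˣ) :
    ((scalarUnit k A t * u : Aˣ) : A) = (t : k) • (u : A) :=
  (Algebra.smul_def (t : k) (u : A)).symm

theorem Ad_apply (u : Aˣ) (x : A) : Ad (k := k) u x = u * x * ↑u⁻¹ := rfl

theorem Ad_mul (u v : Aˣ) : Ad (k := k) (u * v) = Ad u * Ad v := by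
  ext x
  simp [Ad_apply, mul_assoc]

theorem Ad_one : Ad (k := k) (1 : Aˣ) = 1 := by
  ext x
  simp [Ad_apply]

theorem Ad_pow (u : Aˣ) (n : ℕ) : Ad (k := k) (u ^ n) = Ad u ^ n := by
  induction n with
  | zero => simp [Ad_one]
  | succ n ih => rw [pow_succ, pow_succ, Ad_mul, ih]

theorem Ad_scalarUnit (t : kˣ) : Ad (k := k) (scalarUnit k A t) = 1 := by
  ext x
  rw [Ad_apply]
  show algebraMap k A t * x * _ = x
  rw [Algebra.commutes, mul_assoc]
  show x * (scalarUnit k A t * ↑(scalarUnit k A t)⁻¹) = x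
  simp

end ScalarUnit

section MatrixUnits

variable {k : Type*} [Field k] {m : ℕ} [NeZero m] {θ : kˣ}

theorem pUnit_one_apply (i j : Fin m) :
    (pUnit m (1 : kˣ) : Matrix (Fin m) (Fin m) k) i j = if i = j + 1 then 1 else 0 := by
  simp [pUnit]

theorem pUnit_one_pow_apply (n : ℕ) (i j : Fin m) :
    ((pUnit m (1 : kˣ) : Matrix (Fin m) (Fin m) k) ^ n) i j =
      if i = j + n • (1 : Fin m) then 1 else 0 := by
  induction n generalizing j with
  | zero => simp [Matrix.one_apply]
  | succ n ih =>
    rw [pow_succ, Matrix.mul_apply, Finset.sum_eq_single (j + 1)]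
    · rw [ih, pUnit_one_apply]
      simp [succ_nsmul', add_assoc]
    · intro l _ hl
      simp [pUnit_one_apply, hl]
    · simp

theorem pUnit_one_pow : pUnit m (1 : kˣ) ^ m = 1 := by
  ext i j
  have h : m • (1 : Fin m) = 0 := by simpa using card_nsmul_eq_zero (x := (1 : Fin m))
  rw [Units.val_pow_eq_pow_val, pUnit_one_pow_apply, h]
  simp [Matrix.one_apply]

theorem dUnit_pow (hθ : θ ^ m = 1) : dUnit m θ ^ m = 1 := by
  ext i j
  have h : ((θ : k) ^ m) = 1 := by simpa using congrArg Units.val hθ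
  simp only [dUnit, Units.val_pow_eq_pow_val, Matrix.diagonal_pow, Units.val_one]
  congr 1
  funext i
  rw [Pi.pow_apply, ← pow_mul, mul_comm, pow_mul, h, one_pow]

theorem dUnit_mul_pUnit (hθ : θ ^ m = 1) :
    dUnit m θ * pUnit m 1 = scalarUnit k _ θ * (pUnit m 1 * dUnit m θ) := by
  have h : ((θ : k) ^ m) = 1 := by simpa using congrArg Units.val hθ
  ext i j
  rw [val_scalarUnit_mul, Units.val_mul, Units.val_mul]
  simp only [dUnit, Matrix.diagonal_mul, Matrix.smul_apply, Matrix.mul_diagonal, pUnit_one_apply,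
    smul_eq_mul]
  split_ifs with hij
  · subst hij
    rw [one_mul, mul_one, ← pow_succ', Fin.val_add, Fin.val_one', Nat.add_mod_mod,
      pow_eq_pow_mod (j.val + 1) h]
  · simp

theorem pUnit_mul_dUnit_inv (hθ : θ ^ m = 1) :
    pUnit m 1 * (dUnit m θ)⁻¹ = scalarUnit k _ θ * ((dUnit m θ)⁻¹ * pUnit m 1) := by
  rw [← mul_assoc, ((scalarUnit_commute θ _).inv_right).eq, mul_assoc, eq_inv_mul_iff_mul_eq,
    ← mul_assoc, dUnit_mul_pUnit hθ]
  simp [mul_assoc]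

theorem eq_smul_one_of_commute (hθ : orderOf θ = m) {y : Matrix (Fin m) (Fin m) k}
    (hd : (dUnit m θ : Matrix (Fin m) (Fin m) k) * y = y * dUnit m θ)
    (hp : (pUnit m (1 : kˣ) : Matrix (Fin m) (Fin m) k) * y = y * (pUnit m (1 : kˣ)).val) :
    y = y 0 0 • 1 := by
  have off (i j : Fin m) (hij : i ≠ j) : y i j = 0 := by
    have h := congrFun (congrFun hd i) j
    simp only [dUnit, Matrix.diagonal_mul, Matrix.mul_diagonal] at h
    rw [mul_comm, mul_eq_mul_left_iff] at h
    refine h.resolve_left fun h' => hij (Fin.ext ?_)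
    refine pow_injOn_Iio_orderOf (x := θ) (by simp [hθ]) (by simp [hθ]) (Units.ext ?_)
    simpa using h'
  have step (j : Fin m) : y (j + 1) (j + 1) = y j j := by
    have h := congrFun (congrFun hp (j + 1)) j
    simpa [Matrix.mul_apply, pUnit_one_apply] using h.symm
  have diag (n : ℕ) (hn : n < m) : y ⟨n, hn⟩ ⟨n, hn⟩ = y 0 0 := by
    induction n with
    | zero => rfl
    | succ n ih =>
      have h : (⟨n + 1, hn⟩ : Fin m) = ⟨n, n.lt_succ_self.trans hn⟩ + 1 := by
        ext
        rw [Fin.val_add, Fin.val_one', Nat.add_mod_mod, Nat.mod_eq_of_lt hn]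
      rw [h, step, ih]
  ext i j
  by_cases hij : i = j
  · subst hij
    simp [diag i i.2]
  · simp [off i j hij, hij]

end MatrixUnits

section HomogeneousComponents

variable {k : Type*} [Field k] {m : ℕ} [NeZero m] {θ : kˣ}

/-- The unit `p_m(1)^{κ_1} d_m(θ)^{-κ_2}` spanning the component of degree `κ`. -/
def pdMonomial (m : ℕ) [NeZero m] (θ : kˣ) (κ : ℤ × ℤ) : (Matrix (Fin m) (Fin m) k)ˣ :=
  pUnit m 1 ^ κ.1 * (dUnit m θ)⁻¹ ^ κ.2

theorem Ad_dUnit_pdMonomial (hθ : θ ^ m = 1) (κ : ℤ × ℤ) :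
    Ad (k := k) (dUnit m θ) (pdMonomial m θ κ : Matrix (Fin m) (Fin m) k) =
      ((θ ^ κ.1 : kˣ) : k) • (pdMonomial m θ κ : Matrix (Fin m) (Fin m) k) := by
  have h := conj_left_monomial (t := scalarUnit k (Matrix (Fin m) (Fin m) k) θ)
    (u := pUnit m 1) (v := (dUnit m θ)⁻¹) (scalarUnit_commute _ _) (scalarUnit_commute _ _)
    (by rw [inv_inv, dUnit_mul_pUnit hθ]) κ.1 κ.2
  rw [inv_inv, ← map_zpow] at h
  exact (congrArg Units.val h).trans (val_scalarUnit_mul _ _)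

theorem Ad_pUnit_pdMonomial (hθ : θ ^ m = 1) (κ : ℤ × ℤ) :
    Ad (k := k) (pUnit m (1 : kˣ)) (pdMonomial m θ κ : Matrix (Fin m) (Fin m) k) =
      ((θ ^ κ.2 : kˣ) : k) • (pdMonomial m θ κ : Matrix (Fin m) (Fin m) k) := by
  have h := conj_right_monomial (t := scalarUnit k (Matrix (Fin m) (Fin m) k) θ)
    (scalarUnit_commute _ _) (scalarUnit_commute _ _) (pUnit_mul_dUnit_inv hθ) κ.1 κ.2
  rw [← map_zpow] at h
  exact (congrArg Units.val h).trans (val_scalarUnit_mul _ _)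

theorem commute_of_Ad_eq_smul {A : Type*} [Ring A] [Algebra k A] {u w : Aˣ} {x : A} {c : kˣ}
    (hw : Ad (k := k) u (w : A) = (c : k) • (w : A)) (hx : Ad (k := k) u x = (c : k) • x) :
    (u : A) * (x * ↑w⁻¹) = x * ↑w⁻¹ * u := by
  have h : Ad (k := k) u (x * ↑w⁻¹) * Ad (k := k) u (w : A) = Ad (k := k) u x := by
    rw [← map_mul, Units.inv_mul_cancel_right]
  rw [hw, hx, mul_smul_comm] at h
  have h' := smul_left_cancel c (show c • _ = c • _ from h)
  rw [← Units.eq_mul_inv_iff_mul_eq, Ad_apply] at h'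
  exact (Units.mul_inv_eq_iff_eq_mul u).mp h'

theorem exists_eq_smul_pdMonomial (hθ : orderOf θ = m) (κ : ℤ × ℤ)
    {x : Matrix (Fin m) (Fin m) k}
    (hd : Ad (k := k) (dUnit m θ) x = ((θ ^ κ.1 : kˣ) : k) • x)
    (hp : Ad (k := k) (pUnit m (1 : kˣ)) x = ((θ ^ κ.2 : kˣ) : k) • x) :
    ∃ c : k, x = c • (pdMonomial m θ κ : Matrix (Fin m) (Fin m) k) := by
  have hθm : θ ^ m = 1 := hθ ▸ pow_orderOf_eq_one θ
  have h := eq_smul_one_of_commute hθ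
    (commute_of_Ad_eq_smul (k := k) (Ad_dUnit_pdMonomial hθm κ) hd)
    (commute_of_Ad_eq_smul (k := k) (Ad_pUnit_pdMonomial hθm κ) hp)
  rw [Units.mul_inv_eq_iff_eq_mul, smul_mul_assoc, one_mul] at h
  exact ⟨_, h⟩

end HomogeneousComponents

section QuantumTorus

variable {k : Type*} [Field k]

theorem mkAlgHom_ι (θ : k) (i : Fin 4) :
    RingQuot.mkAlgHom k (QRel k θ) (FreeAlgebra.ι k i) = qx k θ i := rfl

theorem qx_zero_mul_qx_two (θ : k) : qx k θ 0 * qx k θ 2 = 1 := by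
  simpa [qx] using RingQuot.mkAlgHom_rel k (QRel.inv_one (k := k) (θ := θ))

theorem qx_two_mul_qx_zero (θ : k) : qx k θ 2 * qx k θ 0 = 1 := by
  simpa [qx] using RingQuot.mkAlgHom_rel k (QRel.inv_one' (k := k) (θ := θ))

theorem qx_one_mul_qx_three (θ : k) : qx k θ 1 * qx k θ 3 = 1 := by
  simpa [qx] using RingQuot.mkAlgHom_rel k (QRel.inv_two (k := k) (θ := θ))

theorem qx_three_mul_qx_one (θ : k) : qx k θ 3 * qx k θ 1 = 1 := by
  simpa [qx] using RingQuot.mkAlgHom_rel k (QRel.inv_two' (k := k) (θ := θ))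

theorem qx_zero_mul_qx_one (θ : k) :
    qx k θ 0 * qx k θ 1 = algebraMap k _ θ * (qx k θ 1 * qx k θ 0) := by
  have h := RingQuot.mkAlgHom_rel k (QRel.q_comm (k := k) (θ := θ))
  simpa only [map_mul, AlgHom.commutes, mkAlgHom_ι] using h

/-- The generator `x_1` of the quantum torus as a unit. -/
def qxUnitOne (θ : k) : (QT k θ)ˣ :=
  ⟨qx k θ 0, qx k θ 2, qx_zero_mul_qx_two θ, qx_two_mul_qx_zero θ⟩

/-- The generator `x_2` of the quantum torus as a unit. -/
def qxUnitTwo (θ : k) : (QT k θ)ˣ :=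
  ⟨qx k θ 1, qx k θ 3, qx_one_mul_qx_three θ, qx_three_mul_qx_one θ⟩

/-- The monomial `x_1^{κ_1} x_2^{κ_2}` in the quantum torus. -/
def qxMonomial (θ : k) (κ : ℤ × ℤ) : (QT k θ)ˣ :=
  qxUnitOne θ ^ κ.1 * qxUnitTwo θ ^ κ.2

theorem qxMonomial_mul (θ : kˣ) (κ μ : ℤ × ℤ) :
    (qxMonomial (θ : k) κ * qxMonomial (θ : k) μ : QT k (θ : k)) =
      ((θ ^ (-(μ.1 * κ.2)) : kˣ) : k) • (qxMonomial (θ : k) (κ + μ) : QT k (θ : k)) := by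
  have h := monomial_mul_monomial (t := scalarUnit k (QT k (θ : k)) θ)
    (u := qxUnitOne (θ : k)) (v := qxUnitTwo (θ : k))
    (scalarUnit_commute _ _) (scalarUnit_commute _ _)
    (Units.ext (qx_zero_mul_qx_one (θ : k))) κ.1 κ.2 μ.1 μ.2
  rw [← map_zpow] at h
  exact (congrArg Units.val h).trans (val_scalarUnit_mul _ _)

theorem adjoin_range_qx (θ : k) : Algebra.adjoin k (Set.range (qx k θ)) = ⊤ := by
  have h : Set.range (qx k θ) =
      RingQuot.mkAlgHom k (QRel k θ) '' Set.range (FreeAlgebra.ι k) := by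
    rw [← Set.range_comp]
    rfl
  rw [h, ← AlgHom.map_adjoin, FreeAlgebra.adjoin_range_ι, Algebra.map_top,
    AlgHom.range_eq_top]
  exact RingQuot.mkAlgHom_surjective k _

theorem span_qxMonomial (θ : kˣ) :
    Submodule.span k (Set.range fun κ => (qxMonomial (θ : k) κ : QT k (θ : k))) = ⊤ := by
  set S := Submodule.span k (Set.range fun κ => (qxMonomial (θ : k) κ : QT k (θ : k)))
  have mem (κ) : (qxMonomial (θ : k) κ : QT k (θ : k)) ∈ S := Submodule.subset_span ⟨κ, rfl⟩
  have h_one : (1 : QT k (θ : k)) ∈ S := by simpa [qxMonomial] using mem 0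
  have h_mul (x y) (hx : x ∈ S) (hy : y ∈ S) : x * y ∈ S := by
    have h : S * S ≤ S := by
      rw [Submodule.span_mul_span, Submodule.span_le]
      rintro _ ⟨_, ⟨κ, rfl⟩, _, ⟨μ, rfl⟩, rfl⟩
      simp only [qxMonomial_mul]
      exact S.smul_mem _ (mem _)
    exact h (Submodule.mul_mem_mul hx hy)
  have h_top : S.toSubalgebra h_one h_mul = ⊤ := by
    rw [← top_le_iff, ← adjoin_range_qx, Algebra.adjoin_le_iff]
    rintro _ ⟨i, rfl⟩
    show qx k (θ : k) i ∈ S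
    fin_cases i
    · simpa [qxMonomial, qxUnitOne] using mem (1, 0)
    · simpa [qxMonomial, qxUnitTwo] using mem (0, 1)
    · simpa [qxMonomial, qxUnitOne] using mem (-1, 0)
    · simpa [qxMonomial, qxUnitTwo] using mem (0, -1)
  rw [← S.toSubalgebra_toSubmodule h_one h_mul, h_top, Algebra.top_toSubmodule]

/-- The homomorphism out of the quantum torus determined by a pair of units `u`, `v` with
`u v = θ v u`. -/
def QT.lift {A : Type*} [Ring A] [Algebra k A] (θ : k) (u v : Aˣ)
    (h : (u * v : A) = algebraMap k A θ * (v * u)) : QT k θ →ₐ[k] A :=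
  RingQuot.liftAlgHom k ⟨FreeAlgebra.lift k ![(u : A), v, ↑u⁻¹, ↑v⁻¹], by
    rintro _ _ (_ | _ | _ | _ | _) <;> simp [h]⟩

section Lift

variable {A : Type*} [Ring A] [Algebra k A] {θ : k} {u v : Aˣ}
  (h : (u * v : A) = algebraMap k A θ * (v * u))

theorem QT.lift_qx_zero : QT.lift θ u v h (qx k θ 0) = u := by
  simp [QT.lift, qx]

theorem QT.lift_qx_one : QT.lift θ u v h (qx k θ 1) = v := by
  simp [QT.lift, qx]

theorem QT.lift_qxMonomial (κ : ℤ × ℤ) :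
    QT.lift θ u v h (qxMonomial θ κ) = ↑(u ^ κ.1 * v ^ κ.2) := by
  have hu : Units.map (QT.lift θ u v h : QT k θ →* A) (qxUnitOne θ) = u :=
    Units.ext (QT.lift_qx_zero h)
  have hv : Units.map (QT.lift θ u v h : QT k θ →* A) (qxUnitTwo θ) = v :=
    Units.ext (QT.lift_qx_one h)
  have hκ : Units.map (QT.lift θ u v h : QT k θ →* A) (qxMonomial θ κ) = u ^ κ.1 * v ^ κ.2 := by
    rw [qxMonomial, map_mul, map_zpow, map_zpow, hu, hv]
  exact congrArg Units.val hκ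

end Lift

end QuantumTorus

section TensorLaurent

variable {k : Type*} [Field k] {A : Type*} [Ring A] [Algebra k A]

/-- The homomorphism `(u, κ) ↦ u ⊗ z^κ` into the units of `A ⊗ S_2`. -/
def tmulMonomial : Aˣ × Multiplicative (ℤ × ℤ) →* (A ⊗[k] STwo k)ˣ :=
  MonoidHom.toHomUnits
    { toFun x := (x.1 : A) ⊗ₜ[k] AddMonoidAlgebra.single x.2.toAdd (1 : k)
      map_one' := rfl
      map_mul' x y := by
        simp [Algebra.TensorProduct.tmul_mul_tmul, AddMonoidAlgebra.single_mul_single] }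

theorem val_tmulMonomial (u : Aˣ) (κ : ℤ × ℤ) :
    (tmulMonomial (k := k) (u, Multiplicative.ofAdd κ) : A ⊗[k] STwo k) =
      (u : A) ⊗ₜ[k] AddMonoidAlgebra.single κ (1 : k) := rfl

theorem tmulMonomial_zpow_mul_zpow (u v : Aˣ) (κ : ℤ × ℤ) :
    tmulMonomial (k := k) (u, Multiplicative.ofAdd (1, 0)) ^ κ.1 *
        tmulMonomial (v, Multiplicative.ofAdd (0, 1)) ^ κ.2 =
      tmulMonomial (u ^ κ.1 * v ^ κ.2, Multiplicative.ofAdd κ) := by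
  rw [← map_zpow, ← map_zpow, ← map_mul, Prod.pow_mk, Prod.pow_mk, Prod.mk_mul_mk,
    ← ofAdd_zsmul, ← ofAdd_zsmul, ← ofAdd_add]
  simp

variable (k A) in
/-- The coefficient of `z^κ` in an element of `A ⊗ S_2`. -/
def tensorCoeff (κ : ℤ × ℤ) : A ⊗[k] STwo k →ₗ[k] A :=
  (TensorProduct.rid k A).toLinearMap ∘ₗ
    (Finsupp.lapply κ ∘ₗ (AddMonoidAlgebra.coeffLinearEquiv k).toLinearMap).lTensor A

theorem tensorCoeff_tmul_single (a : A) (κ μ : ℤ × ℤ) :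
    tensorCoeff k A κ (a ⊗ₜ[k] AddMonoidAlgebra.single μ (1 : k)) = if μ = κ then a else 0 := by
  simp [tensorCoeff, AddMonoidAlgebra.coeffLinearEquiv, Finsupp.single_apply, ite_smul]

theorem linearIndependent_tmul_single [Nontrivial A] (w : ℤ × ℤ → Aˣ) :
    LinearIndependent k fun κ => (w κ : A) ⊗ₜ[k] AddMonoidAlgebra.single κ (1 : k) := by
  rw [linearIndependent_iff']
  intro s g hg κ hκ
  have h := congrArg (tensorCoeff k A κ) hg
  simp only [map_sum, map_smul, tensorCoeff_tmul_single, smul_ite, smul_zero, map_zero,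
    Finset.sum_ite_eq', hκ, if_true] at h
  exact (smul_eq_zero.mp h).resolve_right (w κ).ne_zero

end TensorLaurent

theorem statement8 (k : Type*) [Field k] [IsAlgClosed k] [CharZero k]
    (θ : kˣ) (m : ℕ) [NeZero m] (hord : orderOf θ = m) :
    -- `D_m(θ)` and `P_m(1)` are commuting `k`-algebra automorphisms of `Mat_m(k)`
    -- of period `m`
    Commute (Ad (dUnit m θ) : Matrix (Fin m) (Fin m) k ≃ₐ[k] Matrix (Fin m) (Fin m) k)
      (Ad (pUnit m (1 : kˣ))) ∧
    (Ad (dUnit m θ) : Matrix (Fin m) (Fin m) k ≃ₐ[k] Matrix (Fin m) (Fin m) k) ^ m = 1 ∧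
    (Ad (pUnit m (1 : kˣ)) : Matrix (Fin m) (Fin m) k ≃ₐ[k] Matrix (Fin m) (Fin m) k) ^ m = 1 ∧
    -- there is a `k`-algebra isomorphism from `Q(θ)` onto
    -- `L_{(m,m)}(Mat_m(k), (D_m(θ), P_m(1)), (θ,θ))` with `x_1 ↦ p_m(1) ⊗ z_1` and
    -- `x_2 ↦ d_m(θ)⁻¹ ⊗ z_2`
    ∃ f : QT k (θ : k) →ₐ[k] (Matrix (Fin m) (Fin m) k ⊗[k] STwo k),
      Function.Injective f ∧
      f (qx k (θ : k) 0)
        = (pUnit m (1 : kˣ) : Matrix (Fin m) (Fin m) k)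
            ⊗ₜ[k] AddMonoidAlgebra.single ((1, 0) : ℤ × ℤ) (1 : k) ∧
      f (qx k (θ : k) 1)
        = ((dUnit m θ)⁻¹ : (Matrix (Fin m) (Fin m) k)ˣ).val
            ⊗ₜ[k] AddMonoidAlgebra.single ((0, 1) : ℤ × ℤ) (1 : k) ∧
      f.range = multiloopAssoc k (Matrix (Fin m) (Fin m) k)
        (Ad (dUnit m θ)) (Ad (pUnit m (1 : kˣ))) θ θ := by
  have hθ : θ ^ m = 1 := hord ▸ pow_orderOf_eq_one θ
  set u := tmulMonomial (k := k) (A := Matrix (Fin m) (Fin m) k)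
    (pUnit m 1, Multiplicative.ofAdd (1, 0)) with hu
  set v := tmulMonomial (k := k) (A := Matrix (Fin m) (Fin m) k)
    ((dUnit m θ)⁻¹, Multiplicative.ofAdd (0, 1)) with hv
  have hrel : (u * v : Matrix (Fin m) (Fin m) k ⊗[k] STwo k) =
      algebraMap k _ (θ : k) * (v * u) := by
    rw [hu, hv]
    rw [← Units.val_mul, ← Units.val_mul, ← map_mul, ← map_mul, Prod.mk_mul_mk, Prod.mk_mul_mk,
      ← ofAdd_add, ← ofAdd_add, val_tmulMonomial, val_tmulMonomial, pUnit_mul_dUnit_inv hθ,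
      val_scalarUnit_mul, ← TensorProduct.smul_tmul', ← Algebra.smul_def, add_comm (0, 1)]
  set f := QT.lift (θ : k) u v hrel with hf
  have hmon (κ : ℤ × ℤ) : f (qxMonomial (θ : k) κ) =
      (pdMonomial m θ κ : Matrix (Fin m) (Fin m) k) ⊗ₜ[k] AddMonoidAlgebra.single κ (1 : k) := by
    rw [hf, QT.lift_qxMonomial, hu, hv, tmulMonomial_zpow_mul_zpow, val_tmulMonomial, pdMonomial]
  refine ⟨?_, ?_, ?_, f, ?_, QT.lift_qx_zero hrel, QT.lift_qx_one hrel, ?_⟩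
  · rw [Commute, SemiconjBy, ← Ad_mul, ← Ad_mul, dUnit_mul_pUnit hθ, Ad_mul, Ad_scalarUnit,
      one_mul]
  · rw [← Ad_pow, dUnit_pow hθ, Ad_one]
  · rw [← Ad_pow, pUnit_one_pow, Ad_one]
  · have hli := linearIndependent_tmul_single (k := k) (pdMonomial m θ)
    simp only [← hmon] at hli
    refine (injective_iff_map_eq_zero f).mpr fun x hx => ?_
    have hmem : x ∈ Submodule.span k
        (Set.range fun κ => (qxMonomial (θ : k) κ : QT k (θ : k))) := by
      rw [span_qxMonomial]
      trivial
    obtain ⟨c, rfl⟩ := Finsupp.mem_span_range_iff_exists_finsupp.mp hmem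
    rw [map_finsuppSum] at hx
    simp only [map_smul] at hx
    rw [linearIndependent_iff.mp hli c hx, Finsupp.sum_zero_index]
  · apply le_antisymm
    · rintro _ ⟨x, rfl⟩
      have hle : Submodule.span k
          (Set.range fun κ => (qxMonomial (θ : k) κ : QT k (θ : k))) ≤
          (Subalgebra.toSubmodule (multiloopAssoc k (Matrix (Fin m) (Fin m) k)
            (Ad (dUnit m θ)) (Ad (pUnit m (1 : kˣ))) θ θ)).comap f.toLinearMap := by
        rw [Submodule.span_le]
        rintro _ ⟨κ, rfl⟩
        exact Algebra.subset_adjoin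
          ⟨κ, _, Ad_dUnit_pdMonomial hθ κ, Ad_pUnit_pdMonomial hθ κ, hmon κ⟩
      rw [span_qxMonomial] at hle
      exact hle trivial
    · rw [multiloopAssoc, Algebra.adjoin_le_iff]
      rintro _ ⟨κ, a, hd, hp, rfl⟩
      obtain ⟨c, rfl⟩ := exists_eq_smul_pdMonomial hord κ hd hp
      exact ⟨c • (qxMonomial (θ : k) κ : QT k (θ : k)), by
        rw [AlgHom.toRingHom_eq_coe, RingHom.coe_coe, map_smul, hmon,
          TensorProduct.smul_tmul']⟩
end
end

section
/- Let θ ∈ k^× have finite order m > 1, and let L = sl_1(Q(θ)) = [Q(θ), Q(θ)], a Lie subalgebra of Q(θ) under the commutator bracket. If x ∈ L and the adjoint endomorphism ad(x) : L → L, y ↦ ⁅x,y⁆, is nilpotent, then x = 0. (In other words, sl_1(Q(θ)) is anisotropic: its only ad-nilpotent element is 0.) -/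
noncomputable section

namespace QuantumTorus

variable {k : Type*} [Field k] {θ : k}

lemma qx_zero_mul_two : qx k θ 0 * qx k θ 2 = 1 := by
  simpa [qx] using RingQuot.mkAlgHom_rel k (QRel.inv_one (k := k) (θ := θ))

lemma qx_two_mul_zero : qx k θ 2 * qx k θ 0 = 1 := by
  simpa [qx] using RingQuot.mkAlgHom_rel k (QRel.inv_one' (k := k) (θ := θ))

lemma qx_one_mul_three : qx k θ 1 * qx k θ 3 = 1 := by
  simpa [qx] using RingQuot.mkAlgHom_rel k (QRel.inv_two (k := k) (θ := θ))

lemma qx_three_mul_one : qx k θ 3 * qx k θ 1 = 1 := by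
  simpa [qx] using RingQuot.mkAlgHom_rel k (QRel.inv_two' (k := k) (θ := θ))

lemma qx_zero_mul_one :
    qx k θ 0 * qx k θ 1 = algebraMap k (QT k θ) θ * (qx k θ 1 * qx k θ 0) := by
  simpa only [qx, map_mul, AlgHom.commutes] using
    RingQuot.mkAlgHom_rel k (QRel.q_comm (k := k) (θ := θ))

/-- The generator `x₁` as a unit. -/
def unitOne (k : Type*) [Field k] (θ : k) : (QT k θ)ˣ :=
  ⟨qx k θ 0, qx k θ 2, qx_zero_mul_two, qx_two_mul_zero⟩

/-- The generator `x₂` as a unit. -/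
def unitTwo (k : Type*) [Field k] (θ : k) : (QT k θ)ˣ :=
  ⟨qx k θ 1, qx k θ 3, qx_one_mul_three, qx_three_mul_one⟩

/-- The monomial `x₁ ^ a * x₂ ^ b` for an exponent `(a, b)`. -/
def monomial (k : Type*) [Field k] (θ : k) (γ : ℤ ×ₗ ℤ) : QT k θ :=
  ↑(unitOne k θ ^ (ofLex γ).1 * unitTwo k θ ^ (ofLex γ).2)

lemma zpow_mul_zpow_of_mul_eq {G : Type*} [Group G] {t u v : G} (htu : Commute t u)
    (htv : Commute t v) (h : u * v = t * (v * u)) (b c : ℤ) :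
    v ^ b * u ^ c = t ^ (-(b * c)) * (u ^ c * v ^ b) := by
  have h1 : SemiconjBy u v (t * v) := by rw [SemiconjBy, h, mul_assoc]
  have h2 : SemiconjBy u (v ^ b) (t ^ b * v ^ b) := by
    rw [← htv.mul_zpow]; exact h1.zpow_right b
  have h3 : SemiconjBy (v ^ b) u (t ^ (-b) * u) := by
    rw [SemiconjBy, mul_assoc, h2.eq, ← mul_assoc, ← mul_assoc, zpow_neg, inv_mul_cancel, one_mul]
  have h4 : SemiconjBy (v ^ b) (u ^ c) ((t ^ (-b)) ^ c * u ^ c) := by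
    rw [← (htu.zpow_left (-b)).mul_zpow]; exact h3.zpow_right c
  rw [h4.eq, ← zpow_mul, neg_mul, mul_assoc]

lemma monomial_mul (θ : kˣ) (γ δ : ℤ ×ₗ ℤ) :
    monomial k (θ : k) γ * monomial k (θ : k) δ =
      ((θ ^ (-((ofLex γ).2 * (ofLex δ).1)) : kˣ) : k) • monomial k (θ : k) (γ + δ) := by
  set t : (QT k (θ : k))ˣ := Units.map (algebraMap k (QT k (θ : k))).toMonoidHom θ with ht
  have hc : ∀ u, Commute t u := fun u ↦ Units.ext (Algebra.commutes (θ : k) (u : QT k (θ : k)))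
  have h : unitOne k (θ : k) * unitTwo k (θ : k) = t * (unitTwo k (θ : k) * unitOne k (θ : k)) :=
    Units.ext qx_zero_mul_one
  have key := zpow_mul_zpow_of_mul_eq (hc _) (hc _) h (ofLex γ).2 (ofLex δ).1
  have h2 : ∀ n : ℤ, ((t ^ n : (QT k (θ : k))ˣ) : QT k (θ : k)) =
      algebraMap k _ ((θ ^ n : kˣ) : k) := fun n ↦ by
    rw [ht, ← map_zpow]; rfl
  rw [Algebra.smul_def, ← h2]
  simp only [monomial, ← Units.val_mul]
  congr 1
  have hz := (hc (unitOne k (θ : k) ^ (ofLex γ).1)).zpow_left (-((ofLex γ).2 * (ofLex δ).1))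
  rw [ofLex_add, Prod.fst_add, Prod.snd_add, zpow_add, zpow_add,
    mul_assoc, ← mul_assoc (unitTwo k (θ : k) ^ _), key]
  simp only [← mul_assoc]
  rw [hz.eq]

lemma span_range_monomial (θ : kˣ) :
    Submodule.span k (Set.range (monomial k (θ : k))) = ⊤ := by
  rw [eq_top_iff]
  intro x _
  obtain ⟨a, rfl⟩ := RingQuot.mkAlgHom_surjective k (QRel k (θ : k)) x
  have hM : ∀ γ, monomial k (θ : k) γ ∈ Submodule.span k (Set.range (monomial k (θ : k))) :=
    fun γ ↦ Submodule.subset_span ⟨γ, rfl⟩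
  induction a using FreeAlgebra.induction with
  | grade0 r =>
    rw [AlgHom.commutes, Algebra.algebraMap_eq_smul_one]
    refine Submodule.smul_mem _ _ ?_
    simpa [monomial] using hM 0
  | grade1 i =>
    fin_cases i
    · simpa [monomial, unitOne, qx] using hM (toLex (1, 0))
    · simpa [monomial, unitTwo, qx] using hM (toLex (0, 1))
    · simpa [monomial, unitOne, qx] using hM (toLex (-1, 0))
    · simpa [monomial, unitTwo, qx] using hM (toLex (0, -1))
  | mul a b ha hb =>
    rw [map_mul]
    have h := Submodule.mul_mem_mul (ha trivial) (hb trivial)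
    rw [Submodule.span_mul_span] at h
    refine Submodule.span_le.2 ?_ h
    rintro _ ⟨_, ⟨γ, rfl⟩, _, ⟨δ, rfl⟩, rfl⟩
    simp only [monomial_mul]
    exact Submodule.smul_mem _ _ (hM _)
  | add a b ha hb =>
    rw [map_add]
    exact add_mem (ha trivial) (hb trivial)

/-- The operators on functions `ℤ × ℤ → k` through which the generators act in the regular
representation. -/
def shift (θ : kˣ) : Fin 4 → Module.End k (ℤ × ℤ → k) :=
  ![{ toFun := fun f p ↦ f (p.1 - 1, p.2), map_add' := fun _ _ ↦ rfl, map_smul' := fun _ _ ↦ rfl },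
    { toFun := fun f p ↦ ((θ ^ (-p.1) : kˣ) : k) * f (p.1, p.2 - 1)
      map_add' := fun _ _ ↦ funext fun _ ↦ mul_add _ _ _
      map_smul' := fun _ _ ↦ funext fun _ ↦ mul_left_comm _ _ _ },
    { toFun := fun f p ↦ f (p.1 + 1, p.2), map_add' := fun _ _ ↦ rfl, map_smul' := fun _ _ ↦ rfl },
    { toFun := fun f p ↦ ((θ ^ p.1 : kˣ) : k) * f (p.1, p.2 + 1)
      map_add' := fun _ _ ↦ funext fun _ ↦ mul_add _ _ _
      map_smul' := fun _ _ ↦ funext fun _ ↦ mul_left_comm _ _ _ }]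

/-- The regular representation of the quantum torus, on functions `ℤ × ℤ → k`. -/
def rep (θ : kˣ) : QT k (θ : k) →ₐ[k] Module.End k (ℤ × ℤ → k) :=
  RingQuot.liftAlgHom k ⟨FreeAlgebra.lift k (shift θ), by
    intro a b h
    cases h <;> refine LinearMap.ext fun f ↦ funext fun p ↦ ?_
    · simp [shift]
    · simp [shift]
    · simp [shift, zpow_ne_zero]
    · simp [shift, zpow_ne_zero]
    · simp [shift, Algebra.algebraMap_eq_smul_one, zpow_sub_one₀, mul_assoc]⟩

lemma rep_qx (θ : kˣ) (i : Fin 4) : rep θ (qx k (θ : k) i) = shift θ i := by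
  simp [rep, qx]

lemma rep_unitOne_zpow (θ : kˣ) (n : ℤ) (f : ℤ × ℤ → k) (p : ℤ × ℤ) :
    rep θ ↑(unitOne k (θ : k) ^ n) f p = f (p.1 - n, p.2) := by
  induction n generalizing f p with
  | zero => simp
  | succ n ih =>
    rw [zpow_add_one, Units.val_mul, map_mul, Module.End.mul_apply, ih]
    change rep θ (qx k (θ : k) 0) f _ = _
    rw [rep_qx]
    simp [shift, sub_sub]
  | pred n ih =>
    rw [zpow_sub_one, Units.val_mul, map_mul, Module.End.mul_apply, ih]
    change rep θ (qx k (θ : k) 2) f _ = _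
    rw [rep_qx]
    simp [shift, add_assoc, sub_sub_eq_add_sub, add_comm (1 : ℤ)]

lemma rep_unitTwo_zpow (θ : kˣ) (n : ℤ) (f : ℤ × ℤ → k) (p : ℤ × ℤ) :
    rep θ ↑(unitTwo k (θ : k) ^ n) f p = ((θ ^ (-(n * p.1)) : kˣ) : k) * f (p.1, p.2 - n) := by
  induction n generalizing f p with
  | zero => simp
  | succ n ih =>
    rw [zpow_add_one, Units.val_mul, map_mul, Module.End.mul_apply, ih]
    change _ * rep θ (qx k (θ : k) 1) f _ = _
    rw [rep_qx, show -(((n : ℤ) + 1) * p.1) = -(n * p.1) + -p.1 by ring, zpow_add, Units.val_mul]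
    simp [shift, sub_sub, mul_assoc]
  | pred n ih =>
    rw [zpow_sub_one, Units.val_mul, map_mul, Module.End.mul_apply, ih]
    change _ * rep θ (qx k (θ : k) 3) f _ = _
    rw [rep_qx, show -((-(n : ℤ) - 1) * p.1) = -(-n * p.1) + p.1 by ring, zpow_add, Units.val_mul]
    simp [shift, add_assoc, mul_assoc, sub_sub_eq_add_sub, add_comm (1 : ℤ)]

/-- The coefficient of the monomial with exponent `δ`. -/
def coeff (θ : kˣ) (δ : ℤ ×ₗ ℤ) : QT k (θ : k) →ₗ[k] k :=
  LinearMap.proj (ofLex δ) ∘ₗ LinearMap.applyₗ (Pi.single 0 1) ∘ₗ (rep θ).toLinearMap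

lemma coeff_monomial (θ : kˣ) (γ δ : ℤ ×ₗ ℤ) :
    coeff θ δ (monomial k (θ : k) γ) = if γ = δ then 1 else 0 := by
  change rep θ (monomial k (θ : k) γ) (Pi.single 0 1) (ofLex δ) = _
  rw [monomial, Units.val_mul, map_mul, Module.End.mul_apply, rep_unitOne_zpow, rep_unitTwo_zpow]
  split_ifs with h
  · subst h
    simp [show ((0 : ℤ), (0 : ℤ)) = 0 from rfl]
  · rw [Pi.single_eq_of_ne, mul_zero]
    intro h0
    apply h
    rw [Prod.mk_eq_zero, sub_eq_zero, sub_eq_zero] at h0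
    exact ofLex.injective (Prod.ext h0.1.symm h0.2.symm)

/-- The span of the monomials with exponent lexicographically below `α`. -/
def lower (θ : kˣ) (α : ℤ ×ₗ ℤ) : Submodule k (QT k (θ : k)) :=
  Submodule.span k (monomial k (θ : k) '' Set.Iio α)

lemma coeff_eq_zero_of_mem_lower {θ : kˣ} {α : ℤ ×ₗ ℤ} {x : QT k (θ : k)} (hx : x ∈ lower θ α) :
    coeff θ α x = 0 := by
  have : lower θ α ≤ LinearMap.ker (coeff θ α) := Submodule.span_le.2 <| by
    rintro _ ⟨γ, hγ, rfl⟩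
    simp [coeff_monomial, (Set.mem_Iio.1 hγ).ne]
  exact this hx

lemma mul_mem_lower {θ : kˣ} {s t : Set (ℤ ×ₗ ℤ)} {α : ℤ ×ₗ ℤ}
    (h : ∀ γ ∈ s, ∀ δ ∈ t, γ + δ < α) {x y : QT k (θ : k)}
    (hx : x ∈ Submodule.span k (monomial k (θ : k) '' s))
    (hy : y ∈ Submodule.span k (monomial k (θ : k) '' t)) : x * y ∈ lower θ α := by
  have hxy := Submodule.mul_mem_mul hx hy
  rw [Submodule.span_mul_span] at hxy
  refine Submodule.span_le.2 ?_ hxy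
  rintro _ ⟨_, ⟨γ, hγ, rfl⟩, _, ⟨δ, hδ, rfl⟩, rfl⟩
  simp only [monomial_mul]
  exact Submodule.smul_mem _ _ (Submodule.subset_span ⟨_, h γ hγ δ hδ, rfl⟩)

lemma mul_sub_smul_monomial_mem_lower {θ : kˣ} {α β : ℤ ×ₗ ℤ} {c d : k} {x y : QT k (θ : k)}
    (hx : x - c • monomial k (θ : k) α ∈ lower θ α)
    (hy : y - d • monomial k (θ : k) β ∈ lower θ β) :
    x * y - (c * d * ((θ ^ (-((ofLex α).2 * (ofLex β).1)) : kˣ) : k)) •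
      monomial k (θ : k) (α + β) ∈ lower θ (α + β) := by
  have hα : c • monomial k (θ : k) α ∈ Submodule.span k (monomial k (θ : k) '' {α}) :=
    Submodule.smul_mem _ _ (Submodule.subset_span ⟨α, rfl, rfl⟩)
  have hβ : d • monomial k (θ : k) β ∈ Submodule.span k (monomial k (θ : k) '' {β}) :=
    Submodule.smul_mem _ _ (Submodule.subset_span ⟨β, rfl, rfl⟩)
  have h1 := mul_mem_lower (α := α + β) (fun γ hγ δ hδ ↦ add_lt_add hγ hδ) hx hy
  have h2 := mul_mem_lower (α := α + β) (fun γ hγ δ hδ ↦ add_lt_add_of_lt_of_le hγ (le_of_eq hδ))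
    hx hβ
  have h3 := mul_mem_lower (α := α + β) (fun γ hγ δ hδ ↦ add_lt_add_of_le_of_lt (le_of_eq hγ) hδ)
    hα hy
  convert add_mem (add_mem h1 h2) h3 using 1
  rw [mul_smul, ← monomial_mul, ← smul_mul_smul_comm, sub_mul, sub_mul, mul_sub, mul_sub]
  abel

lemma exists_sub_smul_monomial_mem_lower {θ : kˣ} {x : QT k (θ : k)} (hx : x ≠ 0) :
    ∃ α, coeff θ α x ≠ 0 ∧ x - coeff θ α x • monomial k (θ : k) α ∈ lower θ α := by
  have hs : x ∈ Submodule.span k (Set.range (monomial k (θ : k))) := by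
    rw [span_range_monomial]; trivial
  obtain ⟨c, rfl⟩ := Finsupp.mem_span_range_iff_exists_finsupp.1 hs
  have hc : c.support.Nonempty := by
    rw [Finsupp.support_nonempty_iff]
    rintro rfl
    simp at hx
  have hcoeff : ∀ α, coeff θ α (c.sum fun i a ↦ a • monomial k (θ : k) i) = c α := fun α ↦ by
    simp [Finsupp.sum, coeff_monomial]
  refine ⟨c.support.max' hc, ?_, ?_⟩
  · rw [hcoeff]
    exact Finsupp.mem_support_iff.1 (c.support.max'_mem hc)
  · rw [hcoeff, Finsupp.sum, ← Finset.add_sum_erase _ _ (c.support.max'_mem hc), add_sub_cancel_left]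
    refine Submodule.sum_mem _ fun γ hγ ↦ Submodule.smul_mem _ _ (Submodule.subset_span ⟨γ, ?_, rfl⟩)
    exact Finset.lt_max'_of_mem_erase_max' _ hc hγ

lemma coeff_commutator_eq_zero {θ : kˣ} {α : ℤ ×ₗ ℤ} (h1 : θ ^ (ofLex α).1 = 1)
    (h2 : θ ^ (ofLex α).2 = 1) (a b : QT k (θ : k)) : coeff θ α (a * b - b * a) = 0 := by
  have hspan : ∀ x : QT k (θ : k), x ∈ Submodule.span k (Set.range (monomial k (θ : k))) :=
    fun x ↦ by rw [span_range_monomial]; trivial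
  rw [map_sub, sub_eq_zero]
  induction hspan a using Submodule.span_induction with
  | zero => simp
  | add a a' _ _ h h' => simp only [add_mul, mul_add, map_add, h, h']
  | smul r a _ h => simp only [smul_mul_assoc, mul_smul_comm, map_smul, h]
  | mem a ha =>
    obtain ⟨γ, rfl⟩ := ha
    induction hspan b using Submodule.span_induction with
    | zero => simp
    | add a a' _ _ h h' => simp only [add_mul, mul_add, map_add, h, h']
    | smul r a _ h => simp only [smul_mul_assoc, mul_smul_comm, map_smul, h]
    | mem b hb =>
      obtain ⟨δ, rfl⟩ := hb
      rw [monomial_mul, monomial_mul, add_comm δ γ, map_smul, map_smul, coeff_monomial]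
      split_ifs with h
      · subst h
        rw [ofLex_add, Prod.fst_add] at h1
        rw [ofLex_add, Prod.snd_add] at h2
        congr 2
        have e : -((ofLex γ).2 * (ofLex δ).1) = -((ofLex δ).2 * (ofLex γ).1) +
            (((ofLex γ).1 + (ofLex δ).1) * -(ofLex γ).2 +
              ((ofLex γ).2 + (ofLex δ).2) * (ofLex γ).1) := by ring
        rw [e, zpow_add, zpow_add, zpow_mul, zpow_mul, h1, h2]
        simp
      · simp

lemma iterate_commutator_sub_smul_monomial_mem_lower {θ : kˣ} {α β : ℤ ×ₗ ℤ} {c : k} (hc : c ≠ 0)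
    {x : QT k (θ : k)} (hx : x - c • monomial k (θ : k) α ∈ lower θ α)
    (hαβ : θ ^ ((ofLex α).2 * (ofLex β).1) ≠ θ ^ ((ofLex β).2 * (ofLex α).1)) (n : ℕ) :
    ∃ d : k, d ≠ 0 ∧ (fun y ↦ x * y - y * x)^[n] (monomial k (θ : k) β) -
      d • monomial k (θ : k) (n • α + β) ∈ lower θ (n • α + β) := by
  induction n with
  | zero => exact ⟨1, one_ne_zero, by simp⟩
  | succ n ih =>
    obtain ⟨d, hd, h⟩ := ih
    rw [Function.iterate_succ_apply']
    have hl := mul_sub_smul_monomial_mem_lower hx h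
    have hr := mul_sub_smul_monomial_mem_lower h hx
    have e : α + (n • α + β) = (n + 1) • α + β := by rw [succ_nsmul']; abel
    rw [add_comm _ α, e, mul_comm d c] at hr
    rw [e] at hl
    have hlr := sub_mem hl hr
    have hs (a b : k) (z : QT k (θ : k)) : a • z - b • z = (a - b) • z := by
      simp only [Algebra.smul_def, map_sub, sub_mul]
    rw [sub_sub_sub_comm, hs, ← mul_sub] at hlr
    refine ⟨_, mul_ne_zero (mul_ne_zero hc hd) (sub_ne_zero.2 fun he ↦ hαβ ?_), hlr⟩
    have he := Units.ext he
    have h1 : (ofLex (n • α + β)).1 = n * (ofLex α).1 + (ofLex β).1 :=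
      congrArg (· + (ofLex β).1) (nsmul_eq_mul n (ofLex α).1)
    have h2 : (ofLex (n • α + β)).2 = n * (ofLex α).2 + (ofLex β).2 :=
      congrArg (· + (ofLex β).2) (nsmul_eq_mul n (ofLex α).2)
    rw [h1, h2, mul_add, add_mul, neg_add, neg_add, zpow_add, zpow_add, mul_left_comm, mul_assoc,
      zpow_neg _ ((ofLex α).2 * _), zpow_neg _ ((ofLex β).2 * _)] at he
    exact inv_injective (mul_left_cancel he)

end QuantumTorus

open QuantumTorus in
theorem statement10 (k : Type*) [Field k] [IsAlgClosed k] [CharZero k]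
    (θ : kˣ) (m : ℕ) (hm : 1 < m) (hord : orderOf θ = m)
    (x : QT k (θ : k))
    -- `x` lies in `L = sl_1(Q(θ)) = [Q(θ), Q(θ)]`
    (hx : x ∈ Submodule.span k {z : QT k (θ : k) | ∃ a b : QT k (θ : k), z = a * b - b * a})
    -- `ad(x) : L → L` is nilpotent
    (hnil : ∃ N : ℕ, ∀ y ∈ Submodule.span k
        {z : QT k (θ : k) | ∃ a b : QT k (θ : k), z = a * b - b * a},
        (fun y => x * y - y * x)^[N] y = 0) :
    x = 0 := by
  by_contra hx0
  obtain ⟨N, hN⟩ := hnil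
  obtain ⟨α, hα, hlow⟩ := exists_sub_smul_monomial_mem_lower hx0
  have hβ : ∃ β : ℤ ×ₗ ℤ, θ ^ ((ofLex α).2 * (ofLex β).1) ≠ θ ^ ((ofLex β).2 * (ofLex α).1) := by
    by_contra! h
    have h1 : θ ^ (ofLex α).1 = 1 := by simpa using (h (toLex (0, 1))).symm
    have h2 : θ ^ (ofLex α).2 = 1 := by simpa using h (toLex (1, 0))
    refine hα ((Submodule.span_le (p := LinearMap.ker (coeff θ α))).2 ?_ hx)
    rintro _ ⟨a, b, rfl⟩
    exact coeff_commutator_eq_zero h1 h2 a b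
  obtain ⟨β, hβ⟩ := hβ
  obtain ⟨d, hd, h⟩ := iterate_commutator_sub_smul_monomial_mem_lower hα hlow hβ (N + 1)
  rw [Function.iterate_succ_apply, hN _ (Submodule.subset_span ⟨_, _, rfl⟩), zero_sub] at h
  have h0 := coeff_eq_zero_of_mem_lower h
  rw [map_neg, map_smul, coeff_monomial, if_pos rfl, smul_eq_mul, mul_one, neg_eq_zero] at h0
  exact hd h0
end
end

section
/- Let m ≥ 1, let θ ∈ k^× have order m, and let q ∈ ℤ. Let R_1 = k[t_1^{±1}] be the Laurent polynomial algebra in one variable t_1 over k. Then P_m(t_1)^q is a k-algebra automorphism of Mat_m(R_1) with P_m(t_1)^{qm} = 1, and the (associative) loop algebra L_m(Mat_m(R_1), P_m(t_1)^q, θ) is isomorphic as a k-algebra to the multiloop algebra L_{(m,m)}(Mat_m(k), (D_m(θ), P_m(1)^q), (θ,θ)). -/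
open scoped TensorProduct

noncomputable section

variable {F : Type*} [CommRing F]

/-- The variable `t_1`, as a unit of the Laurent polynomial ring `R_1 = k[t_1^{±1}]`. -/
def tUnit (k : Type*) [Field k] : (LaurentPolynomial k)ˣ where
  val := LaurentPolynomial.T 1
  inv := LaurentPolynomial.T (-1)
  val_inv := by rw [← LaurentPolynomial.T_add]; norm_num
  inv_val := by rw [← LaurentPolynomial.T_add]; norm_num

/-- The generating set `{a ⊗ z^j : a ∈ A^j}` of the (associative) loop algebra
`L_m(A, τ, θ)`. -/
def lGens (k : Type*) [Field k] (A : Type*) [Ring A] [Algebra k A]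
    (τ : A ≃ₐ[k] A) (θ : kˣ) : Set (A ⊗[k] LaurentPolynomial k) :=
  {w | ∃ (j : ℤ) (a : A), τ a = ((θ ^ j : kˣ) : k) • a ∧
    w = a ⊗ₜ[k] LaurentPolynomial.T j}

/-- The (associative) loop algebra `L_m(A, τ, θ) = ⨁_j A^j ⊗ z^j`, as a unital
subalgebra of `A ⊗ k[z^{±1}]`. -/
def loopAssoc (k : Type*) [Field k] (A : Type*) [Ring A] [Algebra k A]
    (τ : A ≃ₐ[k] A) (θ : kˣ) : Subalgebra k (A ⊗[k] LaurentPolynomial k) :=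
  Algebra.adjoin k (lGens k A τ θ)


/-- Intertwining two algebra automorphisms passes to their integer powers. -/
theorem AlgEquiv.intertwine_zpow {k A B : Type*} [CommSemiring k] [Semiring A] [Semiring B]
    [Algebra k A] [Algebra k B] (σ : A ≃ₐ[k] A) (τ : B ≃ₐ[k] B) (f : A → B)
    (h : ∀ x, f (σ x) = τ (f x)) (q : ℤ) (x : A) : f ((σ ^ q) x) = (τ ^ q) (f x) := by
  have key : ∀ (σ : A ≃ₐ[k] A) (τ : B ≃ₐ[k] B), (∀ x, f (σ x) = τ (f x)) →
      ∀ (n : ℕ) x, f ((σ ^ n) x) = (τ ^ n) (f x) := by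
    intro σ τ h n
    induction n with
    | zero => intro x; simp
    | succ n ih => intro x; rw [pow_succ, pow_succ, AlgEquiv.mul_apply, AlgEquiv.mul_apply, ih, h]
  obtain ⟨n, rfl | rfl⟩ := q.eq_nat_or_neg
  · simpa using key σ τ h n x
  · rw [zpow_neg, zpow_neg, ← inv_zpow, ← inv_zpow, zpow_natCast, zpow_natCast]
    refine key _ _ (fun y => ?_) n x
    apply τ.injective
    rw [← h, ← AlgEquiv.mul_apply, ← AlgEquiv.mul_apply, mul_inv_cancel, mul_inv_cancel]
    rfl

theorem Fin.natCast_val_add_one {m : ℕ} [NeZero m] (i : Fin m) :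
    (((i + 1 : Fin m) : ℕ) : ℤ) = i + 1 - if (i : ℕ) = m - 1 then (m : ℤ) else 0 := by
  have hi := i.isLt
  rw [Fin.val_add, Fin.val_one', Nat.add_mod_mod]
  split_ifs with h
  · rw [show (i : ℕ) + 1 = m by omega, Nat.mod_self]
    push_cast
    omega
  · rw [Nat.mod_eq_of_lt (by omega)]
    push_cast
    ring

theorem pUnit_inv_val (m : ℕ) [NeZero m] (u : Fˣ) :
    (((pUnit m u)⁻¹ : (Matrix (Fin m) (Fin m) F)ˣ) : Matrix (Fin m) (Fin m) F) =
      Matrix.of fun i j : Fin m =>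
        if j = i + 1 then (if (i : ℕ) = m - 1 then ((u⁻¹ : Fˣ) : F) else 1) else 0 :=
  rfl

theorem pUnit_conj_apply (k : Type*) [Field k] [Algebra k F] (m : ℕ) [NeZero m] (u : Fˣ)
    (x : Matrix (Fin m) (Fin m) F) (i l : Fin m) :
    Ad (k := k) (pUnit m u) x (i + 1) (l + 1) =
      (if (i : ℕ) = m - 1 then (u : F) else 1) * x i l *
        (if (l : ℕ) = m - 1 then ((u⁻¹ : Fˣ) : F) else 1) := by
  change ((pUnit m u : Matrix (Fin m) (Fin m) F) * x *
    ((pUnit m u)⁻¹ : (Matrix (Fin m) (Fin m) F)ˣ)) (i + 1) (l + 1) = _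
  rw [Matrix.mul_apply, Finset.sum_eq_single l, Matrix.mul_apply, Finset.sum_eq_single i]
  · simp [pUnit, -Matrix.coe_units_inv]
  · intro j _ hj
    simp [pUnit, Ne.symm hj]
  · simp
  · intro j _ hj
    simp [pUnit_inv_val, Ne.symm hj, -Matrix.coe_units_inv]
  · simp

theorem Matrix.ext_add_one {m : ℕ} [NeZero m] {α : Type*} {x y : Matrix (Fin m) (Fin m) α}
    (h : ∀ i l, x (i + 1) (l + 1) = y (i + 1) (l + 1)) : x = y := by
  ext i l
  simpa using h (i - 1) (l - 1)

theorem Ad_pUnit_one_pow (k : Type*) [Field k] [Algebra k F] (m : ℕ) [NeZero m] :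
    (Ad (pUnit m (1 : Fˣ)) : Matrix (Fin m) (Fin m) F ≃ₐ[k] _) ^ m = 1 := by
  have key : ∀ (n : ℕ) (x : Matrix (Fin m) (Fin m) F) (i l : Fin m),
      ((Ad (pUnit m (1 : Fˣ)) : Matrix (Fin m) (Fin m) F ≃ₐ[k] _) ^ n) x
        (i + n • 1) (l + n • 1) = x i l := by
    intro n
    induction n with
    | zero => intro x i l; simp
    | succ n ih =>
      intro x i l
      rw [pow_succ', AlgEquiv.mul_apply, succ_nsmul, ← add_assoc, ← add_assoc,
        pUnit_conj_apply, ih]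
      simp
  have hm : m • (1 : Fin m) = 0 := by
    simpa using card_nsmul_eq_zero (G := Fin m) (x := 1)
  refine AlgEquiv.ext fun x => ?_
  ext i l
  simpa only [hm, add_zero, AlgEquiv.one_apply] using key m x i l

section Realization

variable (k : Type*) [Field k] (m : ℕ)

/-- The monomial `z_1` as a unit of `S_2`. -/
def zUnit : (STwo k)ˣ where
  val := AddMonoidAlgebra.single (1, 0) 1
  inv := AddMonoidAlgebra.single (-1, 0) 1
  val_inv := by
    simp [AddMonoidAlgebra.single_mul_single, AddMonoidAlgebra.one_def, ← Prod.mk_zero_zero]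
  inv_val := by
    simp [AddMonoidAlgebra.single_mul_single, AddMonoidAlgebra.one_def, ← Prod.mk_zero_zero]

@[simp]
theorem zUnit_val : (zUnit k : STwo k) = AddMonoidAlgebra.single (1, 0) 1 := rfl

@[simp]
theorem zUnit_inv_val :
    (((zUnit k)⁻¹ : (STwo k)ˣ) : STwo k) = AddMonoidAlgebra.single (-1, 0) 1 := rfl

@[simp]
theorem tUnit_val : (tUnit k : LaurentPolynomial k) = LaurentPolynomial.T 1 := rfl

@[simp]
theorem tUnit_inv_val :
    (((tUnit k)⁻¹ : (LaurentPolynomial k)ˣ) : LaurentPolynomial k) = LaurentPolynomial.T (-1) := rfl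

/-- The substitution `t_1 ↦ z_1 ^ m`. -/
def firstVar : LaurentPolynomial k →ₐ[k] STwo k :=
  AddMonoidAlgebra.mapDomainAlgHom k k
    ((AddMonoidHom.inl ℤ ℤ).comp (AddMonoidHom.mulLeft (m : ℤ)))

/-- The substitution `z ↦ z_2`. -/
def secondVar : LaurentPolynomial k →ₐ[k] STwo k :=
  AddMonoidAlgebra.mapDomainAlgHom k k (AddMonoidHom.inr ℤ ℤ)

theorem firstVar_single (n : ℤ) (r : k) :
    firstVar k m (AddMonoidAlgebra.single n r) = AddMonoidAlgebra.single ((m : ℤ) * n, 0) r := by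
  exact AddMonoidAlgebra.mapDomain_single

theorem secondVar_single (n : ℤ) (r : k) :
    secondVar k (AddMonoidAlgebra.single n r) = AddMonoidAlgebra.single (0, n) r := by
  exact AddMonoidAlgebra.mapDomain_single

@[simp]
theorem firstVar_T (n : ℤ) :
    firstVar k m (LaurentPolynomial.T n) = AddMonoidAlgebra.single ((m : ℤ) * n, 0) 1 :=
  firstVar_single k m n 1

@[simp]
theorem secondVar_T (n : ℤ) :
    secondVar k (LaurentPolynomial.T n) = AddMonoidAlgebra.single (0, n) 1 :=
  secondVar_single k n 1

/-- The embedding `Mat_m(R_1) → Mat_m(S_2)` sending `t_1 ^ n E_{il}` to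
`z_1 ^ (m n + i - l) E_{il}`. -/
def matEmb : Matrix (Fin m) (Fin m) (LaurentPolynomial k) →ₐ[k] Matrix (Fin m) (Fin m) (STwo k) :=
  (Ad (k := k) (dUnit m (zUnit k))).toAlgHom.comp (firstVar k m).mapMatrix

theorem matEmb_apply (x : Matrix (Fin m) (Fin m) (LaurentPolynomial k)) (i l : Fin m) :
    matEmb k m x i l =
      firstVar k m (x i l) * AddMonoidAlgebra.single ((i : ℤ) - (l : ℤ), 0) 1 := by
  change (Matrix.diagonal (fun i : Fin m => (zUnit k : STwo k) ^ (i : ℕ)) *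
    x.map (firstVar k m) *
    Matrix.diagonal (fun i : Fin m => (((zUnit k)⁻¹ : (STwo k)ˣ) : STwo k) ^ (i : ℕ))) i l = _
  rw [Matrix.mul_diagonal, Matrix.diagonal_mul, Matrix.map_apply, mul_comm _ (firstVar k m _),
    mul_assoc]
  simp [AddMonoidAlgebra.single_pow, AddMonoidAlgebra.single_mul_single,
    sub_eq_add_neg]

theorem matEmb_Ad_pUnit [NeZero m] (x : Matrix (Fin m) (Fin m) (LaurentPolynomial k)) :
    matEmb k m (Ad (k := k) (pUnit m (tUnit k)) x) =
      Ad (k := k) (pUnit m (1 : (STwo k)ˣ)) (matEmb k m x) := by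
  apply Matrix.ext_add_one
  intro i l
  rw [pUnit_conj_apply, matEmb_apply, pUnit_conj_apply, matEmb_apply, map_mul, map_mul,
    Fin.natCast_val_add_one, Fin.natCast_val_add_one, mul_comm _ (firstVar k m (x i l)), mul_assoc,
    mul_assoc]
  split_ifs <;>
    simp [AddMonoidAlgebra.single_mul_single] <;>
    exact Or.inl (by ring_nf)

/-- The embedding `Mat_m(R_1) ⊗ k[z^{±1}] → Mat_m(S_2)`. -/
def loopEmb : Matrix (Fin m) (Fin m) (LaurentPolynomial k) ⊗[k] LaurentPolynomial k →ₐ[k]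
    Matrix (Fin m) (Fin m) (STwo k) :=
  Algebra.TensorProduct.lift (matEmb k m)
    (((Algebra.ofId (STwo k) (Matrix (Fin m) (Fin m) (STwo k))).restrictScalars k).comp
      (secondVar k))
    fun _ y => (Algebra.commutes (secondVar k y) _).symm

theorem loopEmb_tmul (x : Matrix (Fin m) (Fin m) (LaurentPolynomial k)) (f : LaurentPolynomial k) :
    loopEmb k m (x ⊗ₜ f) = secondVar k f • matEmb k m x := by
  rw [Algebra.smul_def, Algebra.commutes]
  rfl

/-- A linear left inverse of `loopEmb`. -/
def loopRetraction : Matrix (Fin m) (Fin m) (STwo k) →ₗ[k]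
    Matrix (Fin m) (Fin m) (LaurentPolynomial k) ⊗[k] LaurentPolynomial k :=
  Matrix.liftLinear k fun i l =>
    (Finsupp.linearCombination k fun κ : ℤ × ℤ =>
      (Matrix.single i l (AddMonoidAlgebra.single ((κ.1 - ((i : ℤ) - (l : ℤ))) / (m : ℤ)) (1 : k)) :
        Matrix (Fin m) (Fin m) (LaurentPolynomial k)) ⊗ₜ[k]
        (AddMonoidAlgebra.single κ.2 (1 : k) : LaurentPolynomial k)) ∘ₗ
    (AddMonoidAlgebra.coeffLinearEquiv (S := k) (M := ℤ × ℤ) k).toLinearMap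

theorem matEmb_single (i l : Fin m) (f : LaurentPolynomial k) :
    matEmb k m (Matrix.single i l f) =
      Matrix.single i l (firstVar k m f * AddMonoidAlgebra.single ((i : ℤ) - (l : ℤ), 0) 1) := by
  ext1 a b
  rw [matEmb_apply, Matrix.single_apply, Matrix.single_apply]
  split_ifs with h
  · rw [h.1, h.2]
  · simp

theorem loopEmb_injective [NeZero m] : Function.Injective (loopEmb k m) := by
  have key : (loopRetraction k m) ∘ₗ (loopEmb k m).toLinearMap = LinearMap.id := by
    refine TensorProduct.ext (Matrix.ext_linearMap _ fun i l => ?_)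
    refine AddMonoidAlgebra.lhom_ext' fun n => LinearMap.ext_ring ?_
    refine AddMonoidAlgebra.lhom_ext' fun j => LinearMap.ext_ring ?_
    have hm : (m : ℤ) ≠ 0 := by exact_mod_cast NeZero.ne m
    simp [loopEmb_tmul, matEmb_single, loopRetraction, AddMonoidAlgebra.single_mul_single,
      Matrix.smul_single, AddMonoidAlgebra.coeffLinearEquiv, Int.mul_ediv_cancel_left _ hm]
  exact Function.LeftInverse.injective (g := loopRetraction k m) fun x => LinearMap.congr_fun key x

theorem matEmb_injective [NeZero m] : Function.Injective (matEmb k m) := by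
  intro x y h
  have h2 : x ⊗ₜ[k] (1 : LaurentPolynomial k) = y ⊗ₜ[k] (1 : LaurentPolynomial k) := by
    apply loopEmb_injective k m
    rw [loopEmb_tmul, loopEmb_tmul, h]
  exact Algebra.TensorProduct.includeLeft_injective (S := k)
    (FaithfulSMul.algebraMap_injective k (LaurentPolynomial k)) h2

/-- The identification `Mat_m(k) ⊗ S_2 ≃ Mat_m(S_2)`. -/
def multiEquiv : Matrix (Fin m) (Fin m) k ⊗[k] STwo k ≃ₐ[k] Matrix (Fin m) (Fin m) (STwo k) :=
  (Algebra.TensorProduct.comm k _ _).trans (matrixEquivTensor (Fin m) k (STwo k)).symm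

theorem multiEquiv_tmul_single (a : Matrix (Fin m) (Fin m) k) (κ : ℤ × ℤ) :
    multiEquiv k m (a ⊗ₜ AddMonoidAlgebra.single κ 1) =
      a.map (AddMonoidAlgebra.single κ) := by
  change (matrixEquivTensor (Fin m) k (STwo k)).symm (AddMonoidAlgebra.single κ 1 ⊗ₜ a) = _
  rw [matrixEquivTensor_apply_symm]
  ext1 i l
  simp [AddMonoidAlgebra.single_mul_single]

theorem coeff_Ad_pUnit_one [NeZero m] (κ : ℤ × ℤ) (x : Matrix (Fin m) (Fin m) (STwo k)) :
    (Ad (k := k) (pUnit m (1 : (STwo k)ˣ)) x).map (fun f => f.coeff κ) =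
      Ad (k := k) (pUnit m (1 : kˣ)) (x.map fun f => f.coeff κ) := by
  apply Matrix.ext_add_one
  intro i l
  rw [Matrix.map_apply, pUnit_conj_apply, pUnit_conj_apply]
  simp

theorem single_Ad_pUnit_one [NeZero m] (κ : ℤ × ℤ) (a : Matrix (Fin m) (Fin m) k) :
    (Ad (k := k) (pUnit m (1 : kˣ)) a).map (AddMonoidAlgebra.single κ) =
      Ad (k := k) (pUnit m (1 : (STwo k)ˣ)) (a.map (AddMonoidAlgebra.single κ)) := by
  apply Matrix.ext_add_one
  intro i l
  rw [Matrix.map_apply, pUnit_conj_apply, pUnit_conj_apply]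
  simp

theorem Ad_dUnit_apply (θ : kˣ) (a : Matrix (Fin m) (Fin m) k) (i l : Fin m) :
    Ad (k := k) (dUnit m θ) a i l = ((θ ^ ((i : ℤ) - (l : ℤ)) : kˣ) : k) * a i l := by
  change (Matrix.diagonal (fun i : Fin m => (θ : k) ^ (i : ℕ)) * a *
    Matrix.diagonal (fun i : Fin m => ((θ⁻¹ : kˣ) : k) ^ (i : ℕ))) i l = _
  rw [Matrix.mul_diagonal, Matrix.diagonal_mul, zpow_sub]
  simp only [zpow_natCast, Units.val_mul, Units.val_pow_eq_pow_val, ← inv_pow]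
  ring

variable {k m}

theorem firstVar_mul_single_coeff (d : ℤ) (g : ℤ × ℤ → k)
    (hg : ∀ n : ℤ, g (m * n + d, 0) = g (d, 0)) (f : LaurentPolynomial k) (κ : ℤ × ℤ) :
    g (d, 0) * (firstVar k m f * AddMonoidAlgebra.single (d, 0) 1).coeff κ =
      g κ * (firstVar k m f * AddMonoidAlgebra.single (d, 0) 1).coeff κ := by
  classical
  induction f using AddMonoidAlgebra.induction_linear with
  | zero => simp
  | add p q hp hq =>
    rw [map_add, add_mul, AddMonoidAlgebra.coeff_add, Finsupp.add_apply, mul_add, mul_add, hp, hq]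
  | single n r =>
    rw [firstVar_single, AddMonoidAlgebra.single_mul_single, AddMonoidAlgebra.coeff_single,
      Finsupp.single_apply]
    split_ifs with h
    · rw [← h]
      simp [hg]
    · simp

theorem loopEmb_tmul_T_mem [NeZero m] {θ : kˣ} (hord : orderOf θ = m) (q : ℤ)
    {a : Matrix (Fin m) (Fin m) (LaurentPolynomial k)} {j : ℤ}
    (ha : ((Ad (k := k) (pUnit m (tUnit k))) ^ q) a = ((θ ^ j : kˣ) : k) • a) :
    loopEmb k m (a ⊗ₜ LaurentPolynomial.T j) ∈
      Algebra.adjoin k (multiEquiv k m '' aGens k (Matrix (Fin m) (Fin m) k)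
          (Ad (dUnit m θ)) ((Ad (pUnit m (1 : kˣ))) ^ q) θ θ) := by
  classical
  set x := matEmb k m a with hx
  have hcoeff : ∀ κ : ℤ × ℤ,
      ((Ad (k := k) (pUnit m (1 : kˣ))) ^ q) (x.map fun f => f.coeff κ) =
        ((θ ^ j : kˣ) : k) • x.map fun f => f.coeff κ := by
    intro κ
    rw [hx, ← AlgEquiv.intertwine_zpow _ _ (fun y => (matEmb k m y).map fun f => f.coeff κ)
      (fun y => by rw [matEmb_Ad_pUnit, coeff_Ad_pUnit_one]), ha]
    ext i l
    simp
  have hfst : ∀ κ : ℤ × ℤ, Ad (k := k) (dUnit m θ) (x.map fun f => f.coeff κ) =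
        ((θ ^ κ.1 : kˣ) : k) • x.map fun f => f.coeff κ := by
    intro κ
    ext i l
    rw [Ad_dUnit_apply, Matrix.smul_apply, smul_eq_mul, Matrix.map_apply, hx, matEmb_apply]
    refine firstVar_mul_single_coeff _ (fun κ => ((θ ^ κ.1 : kˣ) : k)) (fun n => ?_) _ κ
    have hm : θ ^ m = 1 := orderOf_dvd_iff_pow_eq_one.mp hord.dvd
    simp only [zpow_add, zpow_mul, zpow_natCast, hm, one_zpow, one_mul]
  have hsnd : ∀ κ : ℤ × ℤ, (x.map fun f => f.coeff κ) =
      ((θ ^ κ.2 : kˣ) : k) • x.map fun f => f.coeff κ := by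
    intro κ
    ext i l
    rw [Matrix.smul_apply, smul_eq_mul, Matrix.map_apply, hx, matEmb_apply]
    simpa only [zpow_zero, Units.val_one, one_mul] using
      firstVar_mul_single_coeff (m := m) _ (fun κ => ((θ ^ κ.2 : kˣ) : k)) (fun n => rfl) (a i l) κ
  let s : Finset (ℤ × ℤ) := Finset.univ.biUnion fun p : Fin m × Fin m => (x p.1 p.2).coeff.support
  have hsum : loopEmb k m (a ⊗ₜ LaurentPolynomial.T j) = ∑ κ ∈ s,
      multiEquiv k m ((x.map fun f => f.coeff κ) ⊗ₜ
        AddMonoidAlgebra.single (κ.1, κ.2 + j) 1) := by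
    ext1 i l
    have hil : x i l = ∑ κ ∈ s, AddMonoidAlgebra.single κ ((x i l).coeff κ) := by
      conv_lhs => rw [← AddMonoidAlgebra.sum_coeff_single (x i l)]
      exact Finsupp.sum_of_support_subset _
        (Finset.subset_biUnion_of_mem (fun p : Fin m × Fin m => (x p.1 p.2).coeff.support)
          (Finset.mem_univ (i, l))) _ (by simp)
    rw [loopEmb_tmul, ← hx, Matrix.smul_apply, Matrix.sum_apply, secondVar_T]
    conv_lhs => rw [hil]
    rw [Finset.smul_sum]
    refine Finset.sum_congr rfl fun κ _ => ?_
    rw [multiEquiv_tmul_single, smul_eq_mul, AddMonoidAlgebra.single_mul_single]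
    simp [Prod.add_def, add_comm]
  rw [hsum]
  refine Subalgebra.sum_mem _ fun κ _ => Algebra.subset_adjoin
    ⟨_, ⟨(κ.1, κ.2 + j), _, hfst κ, ?_, rfl⟩, rfl⟩
  rw [hcoeff, add_comm κ.2, zpow_add, Units.val_mul, mul_smul, ← hsnd]

theorem exists_matEmb_eq [NeZero m] {θ : kˣ} (hord : orderOf θ = m)
    {a : Matrix (Fin m) (Fin m) k} {n : ℤ}
    (ha : Ad (k := k) (dUnit m θ) a = ((θ ^ n : kˣ) : k) • a) :
    ∃ b, matEmb k m b = a.map (AddMonoidAlgebra.single (n, 0)) := by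
  refine ⟨Matrix.of fun i l => AddMonoidAlgebra.single ((n - ((i : ℤ) - (l : ℤ))) / m) (a i l), ?_⟩
  ext1 i l
  rw [matEmb_apply, Matrix.of_apply, Matrix.map_apply, firstVar_single,
    AddMonoidAlgebra.single_mul_single]
  by_cases h0 : a i l = 0
  · simp [h0]
  have h := congrFun₂ ha i l
  rw [Ad_dUnit_apply, Matrix.smul_apply, smul_eq_mul] at h
  have h1 : θ ^ ((i : ℤ) - (l : ℤ)) = θ ^ n := Units.ext (mul_right_cancel₀ h0 h)
  have hdvd : (m : ℤ) ∣ n - ((i : ℤ) - (l : ℤ)) := by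
    refine (Int.natCast_dvd_natCast.mpr hord.symm.dvd).trans ?_
    rw [orderOf_dvd_iff_zpow_eq_one, zpow_sub, h1, mul_inv_cancel]
  simp [Int.mul_ediv_cancel' hdvd]

theorem multiEquiv_aGens_subset [NeZero m] {θ : kˣ} (hord : orderOf θ = m) (q : ℤ) :
    multiEquiv k m '' aGens k (Matrix (Fin m) (Fin m) k)
        (Ad (dUnit m θ)) ((Ad (pUnit m (1 : kˣ))) ^ q) θ θ ⊆
      loopEmb k m '' lGens k (Matrix (Fin m) (Fin m) (LaurentPolynomial k))
        ((Ad (pUnit m (tUnit k))) ^ q) θ := by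
  rintro _ ⟨_, ⟨κ, a, h1, h2, rfl⟩, rfl⟩
  obtain ⟨b, hb⟩ := exists_matEmb_eq hord h1
  refine ⟨_, ⟨κ.2, b, ?_, rfl⟩, ?_⟩
  · apply matEmb_injective k m
    rw [AlgEquiv.intertwine_zpow _ _ (matEmb k m) (matEmb_Ad_pUnit k m), hb,
      ← AlgEquiv.intertwine_zpow _ _
        (fun y : Matrix (Fin m) (Fin m) k => y.map (AddMonoidAlgebra.single (κ.1, 0)))
        (single_Ad_pUnit_one k m _), h2, map_smul, hb]
    ext1 i l
    simp
  · rw [loopEmb_tmul, hb, multiEquiv_tmul_single, secondVar_T]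
    ext1 i l
    simp [AddMonoidAlgebra.single_mul_single]

theorem map_loopAssoc_eq [NeZero m] {θ : kˣ} (hord : orderOf θ = m) (q : ℤ) :
    (loopAssoc k (Matrix (Fin m) (Fin m) (LaurentPolynomial k))
        ((Ad (pUnit m (tUnit k))) ^ q) θ).map (loopEmb k m) =
      (multiloopAssoc k (Matrix (Fin m) (Fin m) k)
        (Ad (dUnit m θ)) ((Ad (pUnit m (1 : kˣ))) ^ q) θ θ).map
          (multiEquiv k m : _ →ₐ[k] Matrix (Fin m) (Fin m) (STwo k)) := by
  rw [loopAssoc, multiloopAssoc, AlgHom.map_adjoin, AlgHom.map_adjoin]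
  apply le_antisymm
  · refine Algebra.adjoin_le ?_
    rintro _ ⟨_, ⟨j, a, ha, rfl⟩, rfl⟩
    exact loopEmb_tmul_T_mem hord q ha
  · exact Algebra.adjoin_mono (multiEquiv_aGens_subset hord q)

end Realization

theorem statement11 (k : Type*) [Field k] [IsAlgClosed k] [CharZero k]
    (m : ℕ) [NeZero m] (θ : kˣ) (hord : orderOf θ = m) (q : ℤ) :
    -- `P_m(t_1)^q` is a `k`-algebra automorphism of `Mat_m(R_1)` with `P_m(t_1)^{qm} = 1`
    ((Ad (pUnit m (tUnit k)) : Matrix (Fin m) (Fin m) (LaurentPolynomial k) ≃ₐ[k]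
        Matrix (Fin m) (Fin m) (LaurentPolynomial k)) ^ q) ^ m = 1 ∧
    -- `L_m(Mat_m(R_1), P_m(t_1)^q, θ) ≅ L_{(m,m)}(Mat_m(k), (D_m(θ), P_m(1)^q), (θ,θ))`
    -- as `k`-algebras
    Nonempty (
      (↥(loopAssoc k (Matrix (Fin m) (Fin m) (LaurentPolynomial k))
          ((Ad (pUnit m (tUnit k))) ^ q) θ)) ≃ₐ[k]
      (↥(multiloopAssoc k (Matrix (Fin m) (Fin m) k)
          (Ad (dUnit m θ)) ((Ad (pUnit m (1 : kˣ))) ^ q) θ θ))) := by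
  refine ⟨?_, ⟨?_⟩⟩
  · have h : (Ad (pUnit m (tUnit k)) : Matrix (Fin m) (Fin m) (LaurentPolynomial k) ≃ₐ[k]
        Matrix (Fin m) (Fin m) (LaurentPolynomial k)) ^ m = 1 := by
      refine AlgEquiv.ext fun x => matEmb_injective k m ?_
      rw [← zpow_natCast, AlgEquiv.intertwine_zpow _ _ (matEmb k m) (matEmb_Ad_pUnit k m),
        zpow_natCast, Ad_pUnit_one_pow]
      rfl
    rw [← zpow_natCast, ← zpow_mul, mul_comm, zpow_mul, zpow_natCast, h, one_zpow]
  · exact ((Subalgebra.equivMapOfInjective _ _ (loopEmb_injective k m)).trans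
      (Subalgebra.equivOfEq _ _ (map_loopAssoc_eq hord q))).trans
      (Subalgebra.equivMapOfInjective _ _ (multiEquiv k m).injective).symm
end
end
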